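/- arXiv:1608.06215 — 8 statements merged into one kernel-verified Lean document; each statement's English description precedes it below -/
import Mathlib

section
/- Let V be a finite-dimensional complex vector space with a nondegenerate alternating bilinear form ω, and let V = V₁ ⊕ V₂ be a direct sum decomposition with dim V₂ = 2 and ω(v₁, v₂) = 0 for all v₁ ∈ V₁, v₂ ∈ V₂. Let W and W′ be k-dimensional isotropic subspaces of V. Then there exists a linear automorphism g of V satisfying ω(g u, g v) = ω(u, v) for all u, v ∈ V, g(V₁) = V₁, g(V₂) = V₂, and g(W) = W′ if and only if dim pr₁(W) = dim pr₁(W′) and dim pr₂(W) = dim pr₂(W′). (Equivalently: the orbits of the subgroup of the symplectic group of V preserving both V₁ and V₂ on k-dimensional isotropic subspaces are classified by the pair of dimensions of the two projections.) -/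
namespace OrbitAux

variable {V : Type*} [AddCommGroup V] [Module ℂ V] [FiniteDimensional ℂ V]

lemma skew (ω : V →ₗ[ℂ] V →ₗ[ℂ] ℂ) (halt : ∀ v : V, ω v v = 0) (u v : V) :
    ω u v = - ω v u := by
  have h := halt (u + v)
  simp only [map_add, LinearMap.add_apply, halt] at h
  linear_combination h

lemma repr_fun (ω : V →ₗ[ℂ] V →ₗ[ℂ] ℂ) (hnd : ∀ u : V, (∀ v : V, ω u v = 0) → u = 0)
    (l : V →ₗ[ℂ] ℂ) : ∃ y, ω y = l := by
  have hinj : Function.Injective ω := by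
    rw [injective_iff_map_eq_zero]
    intro a ha
    exact hnd a (fun v => by rw [ha]; rfl)
  have hd : Module.finrank ℂ V = Module.finrank ℂ (V →ₗ[ℂ] ℂ) :=
    (Subspace.dual_finrank_eq (K := ℂ) (V := V)).symm
  exact (LinearMap.injective_iff_surjective_of_finrank_eq_finrank hd).1 hinj l

lemma witt_step (ω : V →ₗ[ℂ] V →ₗ[ℂ] ℂ) (halt : ∀ v : V, ω v v = 0)
    (hnd : ∀ u : V, (∀ v : V, ω u v = 0) → u = 0)
    (U : Submodule ℂ V) (f : V →ₗ[ℂ] V)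
    (hf : ∀ u ∈ U, ∀ v ∈ U, ω (f u) (f v) = ω u v)
    (hi : ∀ u ∈ U, f u = 0 → u = 0) (x : V) (hx : x ∉ U) :
    ∃ y, (∀ u ∈ U, ω y (f u) = ω x u) ∧ y ∉ U.map f := by
  -- a solution y0
  obtain ⟨y0, hy0⟩ : ∃ y, ∀ u ∈ U, ω y (f u) = ω x u := by
    have hker : LinearMap.ker (f.domRestrict U) = ⊥ := by
      rw [LinearMap.ker_eq_bot']
      intro m hm
      exact Subtype.ext (hi m m.2 hm)
    obtain ⟨r, hr⟩ := (f.domRestrict U).exists_leftInverse_of_injective hker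
    obtain ⟨y, hy⟩ := repr_fun ω hnd ((ω x) ∘ₗ U.subtype ∘ₗ r)
    refine ⟨y, fun u hu => ?_⟩
    rw [hy]
    have := LinearMap.congr_fun hr ⟨u, hu⟩
    simp only [LinearMap.comp_apply, LinearMap.domRestrict_apply, LinearMap.id_apply] at this
    simp [this]
  by_contra hcon
  push Not at hcon
  obtain ⟨u0, hu0, hfu0⟩ := hcon y0 hy0
  -- perp of f(U) is contained in f(U)
  have hperp : ∀ z, (∀ u ∈ U, ω z (f u) = 0) → z ∈ U.map f := by
    intro z hz
    have h1 := hcon (y0 + z) (fun u hu => by simp [hy0 u hu, hz u hu])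
    have h2 := hcon y0 hy0
    simpa using Submodule.sub_mem _ h1 h2
  let B : LinearMap.BilinForm ℂ V := ω
  have hrefl : B.IsRefl := by
    intro a b hab
    have := skew ω halt b a
    change ω b a = 0
    rw [this, show ω a b = 0 from hab, neg_zero]
  have hB : B.Nondegenerate := by
    refine ⟨fun a ha => hnd a ha, fun a ha => hnd a (fun v => ?_)⟩
    rw [skew ω halt, show ω v a = 0 from ha v, neg_zero]
  have d1 := LinearMap.BilinForm.finrank_orthogonal hB U
  have d2 := LinearMap.BilinForm.finrank_orthogonal hB (U.map f)
  have hfin : Module.finrank ℂ (U.map f) = Module.finrank ℂ U := by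
    apply LinearEquiv.finrank_eq
    symm
    refine LinearEquiv.ofBijective (f.submoduleMap U) ⟨?_, f.submoduleMap_surjective U⟩
    rw [injective_iff_map_eq_zero]
    intro a ha
    exact Subtype.ext (hi a a.2 (congrArg Subtype.val ha))
  have hle : B.orthogonal (U.map f) ≤ (U ⊓ B.orthogonal U).map f := by
    intro z hz
    have hz' : ∀ u ∈ U, ω (f u) z = 0 := fun u hu => hz (f u) (Submodule.mem_map_of_mem hu)
    obtain ⟨w, hw, rfl⟩ := hperp z (fun u hu => by rw [skew ω halt, hz' u hu, neg_zero])
    refine Submodule.mem_map_of_mem ⟨hw, fun u hu => ?_⟩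
    change ω u w = 0
    rw [← hf u hu w hw]; exact hz' u hu
  have d3 := Submodule.finrank_mono hle
  have d4 := Submodule.finrank_map_le f (U ⊓ B.orthogonal U)
  have heq : U ⊓ B.orthogonal U = B.orthogonal U :=
    Submodule.eq_of_le_of_finrank_le inf_le_right (by omega)
  have hmem : x - u0 ∈ B.orthogonal U := by
    intro u hu
    change ω u (x - u0) = 0
    rw [skew ω halt, map_sub, LinearMap.sub_apply, ← hy0 u hu, ← hfu0, hf u0 hu0 u hu]
    simp
  rw [← heq] at hmem
  exact hx (by simpa using U.add_mem hmem.1 hu0)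

lemma witt (ω : V →ₗ[ℂ] V →ₗ[ℂ] ℂ) (halt : ∀ v : V, ω v v = 0)
    (hnd : ∀ u : V, (∀ v : V, ω u v = 0) → u = 0) (n : ℕ) :
    ∀ (U : Submodule ℂ V) (f : V →ₗ[ℂ] V),
    Module.finrank ℂ V - Module.finrank ℂ U = n →
    (∀ u ∈ U, ∀ v ∈ U, ω (f u) (f v) = ω u v) →
    (∀ u ∈ U, f u = 0 → u = 0) →
    ∃ g : V →ₗ[ℂ] V, (∀ u v, ω (g u) (g v) = ω u v) ∧ ∀ u ∈ U, g u = f u := by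
  induction n using Nat.strong_induction_on with
  | _ n ih =>
  intro U f hn hf hi
  by_cases hU : U = ⊤
  · subst hU
    exact ⟨f, fun u v => hf u trivial v trivial, fun _ _ => rfl⟩
  obtain ⟨x, hx⟩ : ∃ x, x ∉ U := by
    by_contra h
    push Not at h
    exact hU (eq_top_iff.2 fun y _ => h y)
  obtain ⟨y, hy, hyU⟩ := witt_step ω halt hnd U f hf hi x hx
  obtain ⟨l, hlx, hl⟩ := Submodule.exists_le_ker_of_notMem hx
  have hlU : ∀ u ∈ U, l u = 0 := fun u hu => hl hu
  let f' : V →ₗ[ℂ] V := f + ((l x)⁻¹ • l).smulRight (y - f x)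
  have hf'U : ∀ u ∈ U, f' u = f u := by
    intro u hu
    simp [f', hlU u hu]
  have hf'x : f' x = y := by
    simp [f', hlx]
  have hdecomp : ∀ v ∈ U ⊔ Submodule.span ℂ {x}, ∃ u ∈ U, ∃ c : ℂ, v = u + c • x := by
    intro v hv
    obtain ⟨u, hu, z, hz, rfl⟩ := Submodule.mem_sup.1 hv
    obtain ⟨c, rfl⟩ := Submodule.mem_span_singleton.1 hz
    exact ⟨u, hu, c, rfl⟩
  have hlt : U < U ⊔ Submodule.span ℂ {x} := by
    refine lt_of_le_of_ne le_sup_left (fun h => hx ?_)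
    rw [h]
    exact Submodule.mem_sup_right (Submodule.mem_span_singleton_self x)
  have hlt' := Submodule.finrank_lt_finrank_of_lt hlt
  have hle := Submodule.finrank_le (U ⊔ Submodule.span ℂ {x})
  obtain ⟨g, hg, hgU⟩ := ih _ (by omega) (U ⊔ Submodule.span ℂ {x}) f' rfl (by
    intro a ha b hb
    obtain ⟨u, hu, c, rfl⟩ := hdecomp a ha
    obtain ⟨v, hv, d, rfl⟩ := hdecomp b hb
    simp only [map_add, map_smul, hf'U u hu, hf'U v hv, hf'x, LinearMap.add_apply,
      LinearMap.smul_apply, hf u hu v hv, halt, hy v hv]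
    rw [skew ω halt (f u) y, hy u hu, skew ω halt u x]) (by
    intro a ha
    obtain ⟨u, hu, c, rfl⟩ := hdecomp a ha
    simp only [map_add, map_smul, hf'U u hu, hf'x]
    intro h0
    by_cases hc : c = 0
    · subst hc
      simp only [zero_smul, add_zero] at h0 ⊢
      exact hi u hu h0
    · exfalso
      apply hyU
      refine ⟨-(c⁻¹ • u), U.neg_mem (U.smul_mem _ hu), ?_⟩
      rw [map_neg, map_smul, eq_neg_of_add_eq_zero_left h0, smul_neg, neg_neg, smul_smul,
        inv_mul_cancel₀ hc, one_smul])
  exact ⟨g, hg, fun u hu => by rw [hgU u (Submodule.mem_sup_left hu), hf'U u hu]⟩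

lemma exists_inj (A B : Submodule ℂ V) (h : Module.finrank ℂ A = Module.finrank ℂ B) :
    ∃ κ : V →ₗ[ℂ] V, (∀ x ∈ A, κ x ∈ B) ∧ ∀ x ∈ A, κ x = 0 → x = 0 := by
  let e := LinearEquiv.ofFinrankEq A B h
  obtain ⟨κ, hκ⟩ := LinearMap.exists_extend (B.subtype ∘ₗ e.toLinearMap)
  have hk : ∀ x (hx : x ∈ A), κ x = e ⟨x, hx⟩ := fun x hx => LinearMap.congr_fun hκ ⟨x, hx⟩
  refine ⟨κ, fun x hx => ?_, fun x hx h0 => ?_⟩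
  · rw [hk x hx]; exact (e _).2
  · rw [hk x hx] at h0
    have : e ⟨x, hx⟩ = 0 := Subtype.ext h0
    simpa using this

lemma exists_sec (W : Submodule ℂ V) (f : V →ₗ[ℂ] V) :
    ∃ s : V →ₗ[ℂ] V, ∀ w ∈ W, s (f w) ∈ W ∧ f (s (f w)) = f w := by
  obtain ⟨r, hr⟩ := (f.submoduleMap W).exists_rightInverse_of_surjective
    (LinearMap.range_eq_top.2 (f.submoduleMap_surjective W))
  obtain ⟨s, hs⟩ := LinearMap.exists_extend (W.subtype ∘ₗ r)
  have hk : ∀ x (hx : x ∈ W.map f), s x = r ⟨x, hx⟩ := fun x hx => LinearMap.congr_fun hs ⟨x, hx⟩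
  refine ⟨s, fun w hw => ?_⟩
  have hm : f w ∈ W.map f := Submodule.mem_map_of_mem hw
  rw [hk _ hm]
  refine ⟨(r _).2, ?_⟩
  exact congrArg Subtype.val (LinearMap.congr_fun hr ⟨f w, hm⟩)

lemma finrank_map_add (W : Submodule ℂ V) (f : V →ₗ[ℂ] V) :
    Module.finrank ℂ (W.map f) + Module.finrank ℂ (W ⊓ LinearMap.ker f : Submodule ℂ V)
      = Module.finrank ℂ W := by
  have h := (f.domRestrict W).finrank_range_add_finrank_ker
  rw [LinearMap.range_domRestrict, LinearMap.ker_domRestrict] at h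
  rw [← h]
  congr 1
  rw [← Submodule.map_comap_subtype]
  exact LinearEquiv.finrank_eq (Submodule.equivSubtypeMap W _).symm

lemma core (ω : V →ₗ[ℂ] V →ₗ[ℂ] ℂ)
    (halt : ∀ v : V, ω v v = 0)
    (hnd : ∀ u : V, (∀ v : V, ω u v = 0) → u = 0)
    (V₁ V₂ : Submodule ℂ V)
    (horth : ∀ v₁ ∈ V₁, ∀ v₂ ∈ V₂, ω v₁ v₂ = 0)
    (W W' : Submodule ℂ V)
    (hWW : Module.finrank ℂ W = Module.finrank ℂ W')
    (q p : V →ₗ[ℂ] V) (hq : ∀ v, q v ∈ V₁) (hp : ∀ v, p v ∈ V₂) (hqp : ∀ v, q v + p v = v)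
    (hq1 : ∀ v ∈ V₁, q v = v) (hq2 : ∀ v ∈ V₂, q v = 0)
    (hp1 : ∀ v ∈ V₁, p v = 0) (hp2 : ∀ v ∈ V₂, p v = v)
    (T h : V →ₗ[ℂ] V) (hh2 : ∀ v ∈ V₂, h v ∈ V₂)
    (hh : ∀ u ∈ V₂, ∀ v ∈ V₂, ω (h u) (h v) = ω u v)
    (hT1 : ∀ w ∈ W, T (q w) ∈ V₁)
    (hT : ∀ u ∈ W, ∀ v ∈ W, ω (T (q u)) (T (q v)) = ω (q u) (q v))
    (hTi : ∀ u ∈ W, T (q u) = 0 → q u = 0)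
    (hTh : ∀ w ∈ W, T (q w) + h (p w) ∈ W') :
    ∃ g : V ≃ₗ[ℂ] V,
        (∀ u v : V, ω (g u) (g v) = ω u v) ∧
        V₁.map g.toLinearMap = V₁ ∧
        V₂.map g.toLinearMap = V₂ ∧
        W.map g.toLinearMap = W' := by
  have horth' : ∀ v₂ ∈ V₂, ∀ v₁ ∈ V₁, ω v₂ v₁ = 0 := fun v₂ h2 v₁ h1 => by
    rw [skew ω halt, horth v₁ h1 v₂ h2, neg_zero]
  have nd2 : ∀ u ∈ V₂, (∀ v ∈ V₂, ω u v = 0) → u = 0 := by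
    intro u hu h0
    refine hnd u fun v => ?_
    rw [← hqp v, map_add, horth' u hu _ (hq v), h0 _ (hp v), add_zero]
  have hhi : ∀ u ∈ V₂, h u = 0 → u = 0 := fun u hu h0 =>
    nd2 u hu fun v hv => by rw [← hh u hu v hv, h0]; simp
  have hdec : ∀ a ∈ W.map q ⊔ V₂, ∃ w ∈ W, ∃ v ∈ V₂, a = q w + v := by
    intro a ha
    obtain ⟨u, ⟨w, hw, rfl⟩, z, hz, rfl⟩ := Submodule.mem_sup.1 ha
    exact ⟨w, hw, z, hz, rfl⟩
  have hF : ∀ w ∈ W, ∀ v ∈ V₂, (T ∘ₗ q + h ∘ₗ p) (q w + v) = T (q w) + h v := by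
    intro w hw v hv
    simp [hq1 _ (hq w), hp1 _ (hq w), hq2 v hv, hp2 v hv]
  obtain ⟨g, hg, hgF⟩ := witt ω halt hnd _ (W.map q ⊔ V₂) (T ∘ₗ q + h ∘ₗ p) rfl (by
      intro a ha b hb
      obtain ⟨w, hw, v, hv, rfl⟩ := hdec a ha
      obtain ⟨w', hw', v', hv', rfl⟩ := hdec b hb
      rw [hF w hw v hv, hF w' hw' v' hv']
      simp only [map_add, LinearMap.add_apply]
      rw [hT w hw w' hw', hh v hv v' hv', horth _ (hT1 w hw) _ (hh2 v' hv'),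
        horth' _ (hh2 v hv) _ (hT1 w' hw'), horth _ (hq w) _ hv', horth' _ hv _ (hq w')]) (by
      intro a ha
      obtain ⟨w, hw, v, hv, rfl⟩ := hdec a ha
      rw [hF w hw v hv]
      intro h0
      have e1 := congrArg q h0
      have e2 := congrArg p h0
      simp only [map_add, hq1 _ (hT1 w hw), hq2 _ (hh2 v hv), hp1 _ (hT1 w hw), hp2 _ (hh2 v hv),
        map_zero, add_zero, zero_add] at e1 e2
      rw [hTi w hw e1, hhi v hv e2, add_zero])
  have hginj : Function.Injective g := by
    rw [injective_iff_map_eq_zero]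
    intro a ha
    exact hnd a fun v => by rw [← hg, ha]; simp
  let G : V ≃ₗ[ℂ] V := LinearEquiv.ofInjectiveEndo g hginj
  have hG : ∀ v, G v = g v := fun v => rfl
  have hmapeq : ∀ A B : Submodule ℂ V, Module.finrank ℂ A = Module.finrank ℂ B →
      (∀ a ∈ A, g a ∈ B) → A.map G.toLinearMap = B := by
    intro A B hd hAB
    refine Submodule.eq_of_le_of_finrank_le ?_ ?_
    · rintro _ ⟨a, ha, rfl⟩
      exact hAB a ha
    · rw [← hd]
      exact (LinearEquiv.finrank_map_eq G A).ge
  have hg2 : ∀ v ∈ V₂, g v = h v := by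
    intro v hv
    rw [hgF v (Submodule.mem_sup_right hv)]
    simp [hq2 v hv, hp2 v hv]
  have h2 : V₂.map G.toLinearMap = V₂ :=
    hmapeq V₂ V₂ rfl fun v hv => by rw [hg2 v hv]; exact hh2 v hv
  refine ⟨G, fun u v => hg u v, hmapeq V₁ V₁ rfl ?_, h2, hmapeq W W' hWW ?_⟩
  · intro v hv
    have : p (g v) = 0 := by
      refine nd2 _ (hp _) fun z hz => ?_
      rw [← h2] at hz
      obtain ⟨z', hz', rfl⟩ := hz
      have e : ω (g v) (g z') = 0 := by rw [hg]; exact horth v hv z' hz'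
      rw [← hqp (g v), map_add, LinearMap.add_apply, horth _ (hq _) (g z')
        (by rw [hg2 z' hz']; exact hh2 z' hz'), zero_add] at e
      exact e
    rw [← hqp (g v), this, add_zero]
    exact hq _
  · intro w hw
    have : w = q w + p w := (hqp w).symm
    have hm : w ∈ W.map q ⊔ V₂ := by
      rw [this]
      exact Submodule.add_mem_sup (Submodule.mem_map_of_mem hw) (hp w)
    rw [hgF w hm]
    exact hTh w hw

lemma line (ω : V →ₗ[ℂ] V →ₗ[ℂ] ℂ) (halt : ∀ v : V, ω v v = 0)
    (V₂ : Submodule ℂ V) (hV₂ : Module.finrank ℂ V₂ = 2)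
    (nd2 : ∀ u ∈ V₂, (∀ v ∈ V₂, ω u v = 0) → u = 0)
    (e : V) (he : e ∈ V₂) (he0 : e ≠ 0) (x : V) (hx : x ∈ V₂) (hex : ω e x = 0) :
    ∃ c : ℂ, c • e = x := by
  by_contra hcon
  push Not at hcon
  have hli : LinearIndependent ℂ ![e, x] := (LinearIndependent.pair_iff' he0).2 hcon
  have hd := finrank_span_eq_card hli
  have hle : Submodule.span ℂ (Set.range ![e, x]) ≤ V₂ := by
    rw [Submodule.span_le]
    rintro _ ⟨i, rfl⟩
    fin_cases i
    · exact he
    · exact hx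
  have heq := Submodule.eq_of_le_of_finrank_le hle (by rw [hd, hV₂]; simp)
  refine he0 (nd2 e he fun v hv => ?_)
  rw [← heq, Matrix.range_cons, Matrix.range_cons, Matrix.range_empty, Set.union_empty,
    Set.singleton_union, Submodule.mem_span_pair] at hv
  obtain ⟨a, b, rfl⟩ := hv
  simp [halt, hex]

lemma exists_h (ω : V →ₗ[ℂ] V →ₗ[ℂ] ℂ) (halt : ∀ v : V, ω v v = 0)
    (V₂ : Submodule ℂ V) (hV₂ : Module.finrank ℂ V₂ = 2)
    (nd2 : ∀ u ∈ V₂, (∀ v ∈ V₂, ω u v = 0) → u = 0)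
    (P P' : Submodule ℂ V) (hP : P ≤ V₂) (hP' : P' ≤ V₂)
    (hd : Module.finrank ℂ P = Module.finrank ℂ P') :
    ∃ h : V →ₗ[ℂ] V, (∀ v ∈ V₂, h v ∈ V₂) ∧
      (∀ u ∈ V₂, ∀ v ∈ V₂, ω (h u) (h v) = ω u v) ∧ ∀ x ∈ P, h x ∈ P' := by
  by_cases h2 : Module.finrank ℂ P = 2
  · have e1 : P' = V₂ := Submodule.eq_of_le_of_finrank_le hP' (by omega)
    refine ⟨LinearMap.id, fun v hv => hv, fun _ _ _ _ => rfl, fun x hx => ?_⟩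
    rw [e1]; exact hP hx
  have hle1 : Module.finrank ℂ P ≤ 1 := by
    have := Submodule.finrank_mono hP
    omega
  have iso : ∀ Q : Submodule ℂ V, Module.finrank ℂ Q ≤ 1 → ∀ u ∈ Q, ∀ v ∈ Q, ω u v = 0 := by
    intro Q hQ u hu v hv
    obtain ⟨e, he⟩ := finrank_le_one_iff.1 hQ
    obtain ⟨a, ha⟩ := he ⟨u, hu⟩
    obtain ⟨b, hb⟩ := he ⟨v, hv⟩
    have ha' : a • (e : V) = u := congrArg Subtype.val ha
    have hb' : b • (e : V) = v := congrArg Subtype.val hb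
    rw [← ha', ← hb']
    simp [halt]
  let ω2 : V₂ →ₗ[ℂ] V₂ →ₗ[ℂ] ℂ := ω.domRestrict₁₂ V₂ V₂
  have hω2 : ∀ u v : V₂, ω2 u v = ω u v := fun _ _ => rfl
  have hfc : ∀ Q : Submodule ℂ V, Q ≤ V₂ →
      Module.finrank ℂ (Q.comap V₂.subtype) = Module.finrank ℂ Q := fun Q hQ =>
    LinearEquiv.finrank_eq (Submodule.comapSubtypeEquivOfLe hQ)
  obtain ⟨κ, hκ, hκi⟩ := exists_inj (P.comap V₂.subtype) (P'.comap V₂.subtype)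
    (by rw [hfc P hP, hfc P' hP', hd])
  obtain ⟨g, hg, hgκ⟩ := witt ω2 (fun v => halt v)
    (fun u hu => Subtype.ext (nd2 u u.2 fun v hv => hu ⟨v, hv⟩)) _ (P.comap V₂.subtype) κ rfl (by
      intro u hu v hv
      rw [hω2, hω2, iso P hle1 u hu v hv]
      exact iso P' (by omega) _ (hκ u hu) _ (hκ v hv)) hκi
  obtain ⟨h, hh⟩ := LinearMap.exists_extend (V₂.subtype ∘ₗ g)
  have hk : ∀ x (hx : x ∈ V₂), h x = g ⟨x, hx⟩ := fun x hx => LinearMap.congr_fun hh ⟨x, hx⟩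
  refine ⟨h, fun v hv => ?_, fun u hu v hv => ?_, fun x hx => ?_⟩
  · rw [hk v hv]; exact (g _).2
  · rw [hk u hu, hk v hv]; exact hg ⟨u, hu⟩ ⟨v, hv⟩
  · rw [hk x (hP hx), hgκ ⟨x, hP hx⟩ hx]
    exact hκ ⟨x, hP hx⟩ hx

lemma backward (ω : V →ₗ[ℂ] V →ₗ[ℂ] ℂ)
    (halt : ∀ v : V, ω v v = 0)
    (hnd : ∀ u : V, (∀ v : V, ω u v = 0) → u = 0)
    (V₁ V₂ : Submodule ℂ V) (hV₂ : Module.finrank ℂ V₂ = 2)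
    (horth : ∀ v₁ ∈ V₁, ∀ v₂ ∈ V₂, ω v₁ v₂ = 0)
    (W W' : Submodule ℂ V)
    (hWW : Module.finrank ℂ W = Module.finrank ℂ W')
    (hWiso : ∀ u ∈ W, ∀ v ∈ W, ω u v = 0)
    (hW'iso : ∀ u ∈ W', ∀ v ∈ W', ω u v = 0)
    (q p : V →ₗ[ℂ] V) (hq : ∀ v, q v ∈ V₁) (hp : ∀ v, p v ∈ V₂) (hqp : ∀ v, q v + p v = v)
    (hq1 : ∀ v ∈ V₁, q v = v) (hq2 : ∀ v ∈ V₂, q v = 0)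
    (hp1 : ∀ v ∈ V₁, p v = 0) (hp2 : ∀ v ∈ V₂, p v = v)
    (hdq : Module.finrank ℂ (W.map q) = Module.finrank ℂ (W'.map q))
    (hdp : Module.finrank ℂ (W.map p) = Module.finrank ℂ (W'.map p)) :
    ∃ g : V ≃ₗ[ℂ] V,
        (∀ u v : V, ω (g u) (g v) = ω u v) ∧
        V₁.map g.toLinearMap = V₁ ∧
        V₂.map g.toLinearMap = V₂ ∧
        W.map g.toLinearMap = W' := by
  have horth' : ∀ v₂ ∈ V₂, ∀ v₁ ∈ V₁, ω v₂ v₁ = 0 := fun v₂ h2 v₁ h1 => by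
    rw [skew ω halt, horth v₁ h1 v₂ h2, neg_zero]
  have nd2 : ∀ u ∈ V₂, (∀ v ∈ V₂, ω u v = 0) → u = 0 := by
    intro u hu h0
    refine hnd u fun v => ?_
    rw [← hqp v, map_add, horth' u hu _ (hq v), h0 _ (hp v), add_zero]
  have hsplit : ∀ u v, ω u v = ω (q u) (q v) + ω (p u) (p v) := by
    intro u v
    conv_lhs => rw [← hqp u, ← hqp v]
    simp only [map_add, LinearMap.add_apply]
    rw [horth _ (hq u) _ (hp v), horth' _ (hp u) _ (hq v)]
    ring
  have hPle : ∀ A : Submodule ℂ V, A.map p ≤ V₂ := by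
    rintro A _ ⟨a, _, rfl⟩
    exact hp a
  obtain ⟨h, hh2, hh, hhP⟩ := exists_h ω halt V₂ hV₂ nd2 _ _ (hPle W) (hPle W') hdp
  have hhi : ∀ u ∈ V₂, h u = 0 → u = 0 := fun u hu h0 =>
    nd2 u hu fun v hv => by rw [← hh u hu v hv, h0]; simp
  have a1 := finrank_map_add W q
  have a2 := finrank_map_add W' q
  have b1 := finrank_map_add W p
  have b2 := finrank_map_add W' p
  obtain ⟨κ, hκ, hκi⟩ := exists_inj (W ⊓ LinearMap.ker p) (W' ⊓ LinearMap.ker p) (by omega)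
  by_cases hb : Module.finrank ℂ (W ⊓ LinearMap.ker q : Submodule ℂ V) = 0
  · have hb' : Module.finrank ℂ (W' ⊓ LinearMap.ker q : Submodule ℂ V) = 0 := by omega
    have z : ∀ w ∈ W, q w = 0 → w = 0 := by
      intro w hw h0
      have : w ∈ W ⊓ LinearMap.ker q := ⟨hw, h0⟩
      rwa [Submodule.finrank_eq_zero.1 hb, Submodule.mem_bot] at this
    have z' : ∀ w ∈ W', q w = 0 → w = 0 := by
      intro w hw h0
      have : w ∈ W' ⊓ LinearMap.ker q := ⟨hw, h0⟩
      rwa [Submodule.finrank_eq_zero.1 hb', Submodule.mem_bot] at this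
    obtain ⟨s, hs⟩ := exists_sec W p
    obtain ⟨s', hs'⟩ := exists_sec W' p
    obtain ⟨r, hr⟩ := exists_sec W q
    let φ : V →ₗ[ℂ] V := κ ∘ₗ (LinearMap.id - s ∘ₗ p) + s' ∘ₗ h ∘ₗ p
    have hφ : ∀ w, φ w = κ (w - s (p w)) + s' (h (p w)) := fun w => rfl
    have hker : ∀ w ∈ W, w - s (p w) ∈ W ⊓ LinearMap.ker p := fun w hw =>
      ⟨W.sub_mem hw (hs w hw).1, by
        change p (w - s (p w)) = 0
        rw [map_sub, (hs w hw).2, sub_self]⟩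
    have hs'h : ∀ w ∈ W, s' (h (p w)) ∈ W' ∧ p (s' (h (p w))) = h (p w) := by
      intro w hw
      obtain ⟨w', hw', e⟩ := hhP (p w) (Submodule.mem_map_of_mem hw)
      rw [← e]
      exact hs' w' hw'
    have hφW : ∀ w ∈ W, φ w ∈ W' := fun w hw =>
      W'.add_mem (hκ _ (hker w hw)).1 (hs'h w hw).1
    have hφp : ∀ w ∈ W, p (φ w) = h (p w) := by
      intro w hw
      have : p (κ (w - s (p w))) = 0 := (hκ _ (hker w hw)).2
      rw [hφ, map_add, this, (hs'h w hw).2, zero_add]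
    have hTq : ∀ w ∈ W, (q ∘ₗ φ ∘ₗ r) (q w) = q (φ w) := by
      intro w hw
      have : r (q w) - w = 0 := z _ (W.sub_mem (hr w hw).1 hw) (by
        rw [map_sub, (hr w hw).2, sub_self])
      simp only [LinearMap.comp_apply]
      rw [sub_eq_zero.1 this]
    refine core ω halt hnd V₁ V₂ horth W W' hWW q p hq hp hqp hq1 hq2 hp1 hp2
      (q ∘ₗ φ ∘ₗ r) h hh2 hh ?_ ?_ ?_ ?_
    · intro w hw
      exact hq _
    · intro u hu v hv
      rw [hTq u hu, hTq v hv]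
      have e1 := hsplit u v
      have e2 := hsplit (φ u) (φ v)
      rw [hWiso u hu v hv] at e1
      rw [hW'iso _ (hφW u hu) _ (hφW v hv), hφp u hu, hφp v hv, hh _ (hp u) _ (hp v)] at e2
      linear_combination e1 - e2
    · intro w hw h0
      rw [hTq w hw] at h0
      have h1 := z' _ (hφW w hw) h0
      have h2 : p w = 0 := hhi _ (hp w) (by rw [← hφp w hw, h1, map_zero])
      have h3 := hφ w
      rw [h1, h2] at h3
      simp only [map_zero, sub_zero, add_zero] at h3
      rw [hκi w ⟨hw, h2⟩ h3.symm, map_zero]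
    · intro w hw
      rw [hTq w hw, ← hφp w hw, hqp]
      exact hφW w hw
  · have key : ∀ A : Submodule ℂ V, (∀ u ∈ A, ∀ v ∈ A, ω u v = 0) →
        Module.finrank ℂ (A ⊓ LinearMap.ker q : Submodule ℂ V) ≠ 0 →
        ∀ w ∈ A, p w ∈ A ∧ q w ∈ A := by
      intro A hA hne w hw
      have hne' : (A ⊓ LinearMap.ker q : Submodule ℂ V) ≠ ⊥ := fun h0 =>
        hne (Submodule.finrank_eq_zero.2 h0)
      obtain ⟨e, ⟨heA, heq⟩, he0⟩ := Submodule.exists_mem_ne_zero_of_ne_bot hne'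
      have heq' : q e = 0 := heq
      have hpe : p e = e := by
        have := hqp e
        rwa [heq', zero_add] at this
      have heV : e ∈ V₂ := hpe ▸ hp e
      have h0 : ω e (p w) = 0 := by
        have := hsplit e w
        rw [hA e heA w hw, heq', hpe] at this
        simpa using this.symm
      obtain ⟨c, hc⟩ := line ω halt V₂ hV₂ nd2 e heV he0 (p w) (hp w) h0
      have hpA : p w ∈ A := hc ▸ A.smul_mem c heA
      refine ⟨hpA, ?_⟩
      have : q w = w - p w := eq_sub_of_add_eq (hqp w)
      rw [this]
      exact A.sub_mem hw hpA
    have kW := key W hWiso hb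
    have kW' := key W' hW'iso (by omega)
    have hqK : ∀ w ∈ W, q w ∈ W ⊓ LinearMap.ker p := fun w hw =>
      ⟨(kW w hw).2, hp1 _ (hq w)⟩
    refine core ω halt hnd V₁ V₂ horth W W' hWW q p hq hp hqp hq1 hq2 hp1 hp2
      κ h hh2 hh ?_ ?_ ?_ ?_
    · intro w hw
      have h0 : p (κ (q w)) = 0 := (hκ _ (hqK w hw)).2
      rw [← hqp (κ (q w)), h0, add_zero]
      exact hq _
    · intro u hu v hv
      rw [hWiso _ (kW u hu).2 _ (kW v hv).2]
      exact hW'iso _ (hκ _ (hqK u hu)).1 _ (hκ _ (hqK v hv)).1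
    · intro w hw h0
      exact hκi _ (hqK w hw) h0
    · intro w hw
      refine W'.add_mem (hκ _ (hqK w hw)).1 ?_
      obtain ⟨w', hw', e⟩ := hhP (p w) (Submodule.mem_map_of_mem hw)
      rw [← e]
      exact (kW' w' hw').1

end OrbitAux


/--
Let `V` be a finite-dimensional complex vector space with a nondegenerate alternating
bilinear form `ω`, and `V = V₁ ⊕ V₂` with `dim V₂ = 2` and `V₁ ⊥ V₂`.  Two `k`-dimensional
isotropic subspaces `W`, `W'` are conjugate under a symplectic automorphism of `V`
preserving `V₁` and `V₂` if and only if the dimensions of their projections to `V₁`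
and to `V₂` agree.
-/
theorem orbit_classification_by_projections
    {V : Type*} [AddCommGroup V] [Module ℂ V] [FiniteDimensional ℂ V]
    (ω : V →ₗ[ℂ] V →ₗ[ℂ] ℂ)
    (halt : ∀ v : V, ω v v = 0)
    (hnd : ∀ u : V, (∀ v : V, ω u v = 0) → u = 0)
    (V₁ V₂ : Submodule ℂ V) (hc : IsCompl V₁ V₂)
    (hV₂ : Module.finrank ℂ V₂ = 2)
    (horth : ∀ v₁ ∈ V₁, ∀ v₂ ∈ V₂, ω v₁ v₂ = 0)
    (k : ℕ) (W W' : Submodule ℂ V)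
    (hW : Module.finrank ℂ W = k) (hW' : Module.finrank ℂ W' = k)
    (hWiso : ∀ u ∈ W, ∀ v ∈ W, ω u v = 0)
    (hW'iso : ∀ u ∈ W', ∀ v ∈ W', ω u v = 0) :
    (∃ g : V ≃ₗ[ℂ] V,
        (∀ u v : V, ω (g u) (g v) = ω u v) ∧
        V₁.map g.toLinearMap = V₁ ∧
        V₂.map g.toLinearMap = V₂ ∧
        W.map g.toLinearMap = W') ↔
    (Module.finrank ℂ (W.map (V₁.subtype ∘ₗ V₁.linearProjOfIsCompl V₂ hc)) =
        Module.finrank ℂ (W'.map (V₁.subtype ∘ₗ V₁.linearProjOfIsCompl V₂ hc)) ∧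
      Module.finrank ℂ (W.map (V₂.subtype ∘ₗ V₂.linearProjOfIsCompl V₁ hc.symm)) =
        Module.finrank ℂ (W'.map (V₂.subtype ∘ₗ V₂.linearProjOfIsCompl V₁ hc.symm))) := by
  let q : V →ₗ[ℂ] V := V₁.subtype ∘ₗ V₁.linearProjOfIsCompl V₂ hc
  let p : V →ₗ[ℂ] V := V₂.subtype ∘ₗ V₂.linearProjOfIsCompl V₁ hc.symm
  have hq : ∀ v, q v ∈ V₁ := fun v => (V₁.linearProjOfIsCompl V₂ hc v).2
  have hp : ∀ v, p v ∈ V₂ := fun v => (V₂.linearProjOfIsCompl V₁ hc.symm v).2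
  have hq1 : ∀ v ∈ V₁, q v = v := fun v hv =>
    congrArg Subtype.val (Submodule.linearProjOfIsCompl_apply_left hc ⟨v, hv⟩)
  have hp2 : ∀ v ∈ V₂, p v = v := fun v hv =>
    congrArg Subtype.val (Submodule.linearProjOfIsCompl_apply_left hc.symm ⟨v, hv⟩)
  have hq2 : ∀ v ∈ V₂, q v = 0 := fun v hv =>
    congrArg Subtype.val ((Submodule.linearProjOfIsCompl_apply_eq_zero_iff hc).2 hv)
  have hp1 : ∀ v ∈ V₁, p v = 0 := fun v hv =>
    congrArg Subtype.val ((Submodule.linearProjOfIsCompl_apply_eq_zero_iff hc.symm).2 hv)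
  have hqp : ∀ v, q v + p v = v := by
    intro v
    have hv : v ∈ V₁ ⊔ V₂ := by rw [hc.sup_eq_top]; trivial
    obtain ⟨a, ha, b, hb, rfl⟩ := Submodule.mem_sup.1 hv
    rw [map_add, map_add, hq1 a ha, hq2 b hb, hp1 a ha, hp2 b hb]
    simp
  change _ ↔ (Module.finrank ℂ (W.map q) = Module.finrank ℂ (W'.map q) ∧
    Module.finrank ℂ (W.map p) = Module.finrank ℂ (W'.map p))
  constructor
  · rintro ⟨g, -, h1, h2, rfl⟩
    have g1 : ∀ v ∈ V₁, g v ∈ V₁ := fun v hv => by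
      have : g v ∈ V₁.map g.toLinearMap := Submodule.mem_map_of_mem hv
      rwa [h1] at this
    have g2 : ∀ v ∈ V₂, g v ∈ V₂ := fun v hv => by
      have : g v ∈ V₂.map g.toLinearMap := Submodule.mem_map_of_mem hv
      rwa [h2] at this
    have cq : q ∘ₗ g.toLinearMap = g.toLinearMap ∘ₗ q := by
      ext v
      change q (g v) = g (q v)
      conv_lhs => rw [← hqp v]
      rw [map_add, map_add, hq1 _ (g1 _ (hq v)), hq2 _ (g2 _ (hp v)), add_zero]
    have cp : p ∘ₗ g.toLinearMap = g.toLinearMap ∘ₗ p := by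
      ext v
      change p (g v) = g (p v)
      conv_lhs => rw [← hqp v]
      rw [map_add, map_add, hp1 _ (g1 _ (hq v)), hp2 _ (g2 _ (hp v)), zero_add]
    constructor
    · rw [← Submodule.map_comp g.toLinearMap q W, cq, Submodule.map_comp q g.toLinearMap W]
      exact (LinearEquiv.finrank_map_eq g (W.map q)).symm
    · rw [← Submodule.map_comp g.toLinearMap p W, cp, Submodule.map_comp p g.toLinearMap W]
      exact (LinearEquiv.finrank_map_eq g (W.map p)).symm
  · rintro ⟨hdq, hdp⟩
    exact OrbitAux.backward ω halt hnd V₁ V₂ hV₂ horth W W' (hW.trans hW'.symm) hWiso hW'iso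
      q p hq hp hqp hq1 hq2 hp1 hp2 hdq hdp
end

section
/- Let W be a k-dimensional isotropic subspace of V (with k ≥ 1). Then the pair of dimensions (dim pr₂(W), dim pr₁(W)) is one of the four pairs (0, k), (1, k), (1, k−1), (2, k). In particular dim pr₁(W) ≥ k − 1, and if dim pr₂(W) = 2 then dim pr₁(W) = k. -/
/--
For a `k`-dimensional isotropic subspace `W` of `V = V₁ ⊕ V₂` (with `dim V₂ = 2`,
`V₁ ⊥ V₂`, `ω` nondegenerate alternating), the pair
`(dim pr₂ W, dim pr₁ W)` is one of `(0, k)`, `(1, k)`, `(1, k−1)`, `(2, k)`.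
In particular `dim pr₁ W ≥ k − 1`, and if `dim pr₂ W = 2` then `dim pr₁ W = k`.
-/
theorem projection_dimensions_of_isotropic
    {V : Type*} [AddCommGroup V] [Module ℂ V] [FiniteDimensional ℂ V]
    (ω : V →ₗ[ℂ] V →ₗ[ℂ] ℂ)
    (halt : ∀ v : V, ω v v = 0)
    (hnd : ∀ u : V, (∀ v : V, ω u v = 0) → u = 0)
    (V₁ V₂ : Submodule ℂ V) (hc : IsCompl V₁ V₂)
    (hV₂ : Module.finrank ℂ V₂ = 2)
    (horth : ∀ v₁ ∈ V₁, ∀ v₂ ∈ V₂, ω v₁ v₂ = 0)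
    (k : ℕ) (hk : 1 ≤ k) (W : Submodule ℂ V)
    (hW : Module.finrank ℂ W = k)
    (hWiso : ∀ u ∈ W, ∀ v ∈ W, ω u v = 0) :
    let pr₁ : V →ₗ[ℂ] V := V₁.subtype ∘ₗ V₁.linearProjOfIsCompl V₂ hc
    let pr₂ : V →ₗ[ℂ] V := V₂.subtype ∘ₗ V₂.linearProjOfIsCompl V₁ hc.symm
    ((Module.finrank ℂ (W.map pr₂) = 0 ∧ Module.finrank ℂ (W.map pr₁) = k) ∨
     (Module.finrank ℂ (W.map pr₂) = 1 ∧ Module.finrank ℂ (W.map pr₁) = k) ∨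
     (Module.finrank ℂ (W.map pr₂) = 1 ∧ Module.finrank ℂ (W.map pr₁) = k - 1) ∨
     (Module.finrank ℂ (W.map pr₂) = 2 ∧ Module.finrank ℂ (W.map pr₁) = k)) ∧
    k - 1 ≤ Module.finrank ℂ (W.map pr₁) ∧
    (Module.finrank ℂ (W.map pr₂) = 2 → Module.finrank ℂ (W.map pr₁) = k) := by
  intro pr₁ pr₂
  have hsum : ∀ v, pr₁ v + pr₂ v = v := fun v =>
    Submodule.projection_add_projection_eq_self hc v
  have h1 : ∀ v, pr₁ v ∈ V₁ := fun v => Submodule.coe_mem _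
  have h2 : ∀ v, pr₂ v ∈ V₂ := fun v => Submodule.coe_mem _
  have hk1 : ∀ v, v ∈ V₂ → pr₁ v = 0 := by
    intro v hv
    have h0 := (Submodule.projectionOnto_apply_eq_zero_iff hc).2 hv
    exact congrArg Subtype.val h0
  have hk1' : ∀ v, pr₁ v = 0 → v ∈ V₂ := by
    intro v hv
    rw [← hsum v, hv, zero_add]; exact h2 v
  have hrank : Module.finrank ℂ (W.map pr₁) + Module.finrank ℂ (W ⊓ V₂ : Submodule ℂ V) = k := by
    have h := LinearMap.finrank_range_add_finrank_ker (pr₁.domRestrict W)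
    rw [hW, LinearMap.range_domRestrict] at h
    rw [← h]
    congr 1
    have e : (W ⊓ V₂ : Submodule ℂ V) =
        (LinearMap.ker (pr₁.domRestrict W)).map W.subtype := by
      ext x
      simp only [Submodule.mem_inf, Submodule.mem_map, LinearMap.mem_ker,
        LinearMap.domRestrict_apply, Submodule.subtype_apply]
      constructor
      · rintro ⟨hx, hx2⟩
        exact ⟨⟨x, hx⟩, hk1 x hx2, rfl⟩
      · rintro ⟨y, hy, rfl⟩
        exact ⟨y.2, hk1' _ hy⟩
    rw [e]
    exact Submodule.finrank_map_subtype_eq _ _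
  have hP : W.map pr₂ ≤ V₂ := by
    rintro _ ⟨w, -, rfl⟩
    exact h2 w
  have hKP : W ⊓ V₂ ≤ W.map pr₂ := by
    rintro x ⟨hx, hx2⟩
    refine ⟨x, hx, ?_⟩
    have h := hsum x
    rwa [hk1 x hx2, zero_add] at h
  have l1 := Submodule.finrank_mono hP
  have l2 := Submodule.finrank_mono hKP
  rw [hV₂] at l1
  have hskew : ∀ u v, ω u v = 0 → ω v u = 0 := by
    intro u v h
    have h3 := halt (u + v)
    simpa [halt, h] using h3
  have key : Module.finrank ℂ (W.map pr₂) = 2 →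
      Module.finrank ℂ (W ⊓ V₂ : Submodule ℂ V) = 0 := by
    intro h
    have e : W.map pr₂ = V₂ := Submodule.eq_of_le_of_finrank_eq hP (h.trans hV₂.symm)
    rw [Submodule.finrank_eq_zero, eq_bot_iff]
    rintro x ⟨hx, hx2⟩
    refine hnd x fun v => ?_
    have hx1 : ∀ u, ω x (pr₁ u) = 0 := fun u => hskew _ _ (horth _ (h1 u) x hx2)
    have hv : pr₂ v ∈ W.map pr₂ := e ▸ h2 v
    obtain ⟨w, hw, hwv⟩ := hv
    have h4 := hWiso x hx w hw
    rw [← hsum w, map_add, hx1, zero_add, hwv] at h4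
    rw [← hsum v, map_add, hx1, zero_add, h4]
  generalize Module.finrank ℂ (W.map pr₂) = a at *
  generalize Module.finrank ℂ (W.map pr₁) = b at *
  generalize Module.finrank ℂ (W ⊓ V₂ : Submodule ℂ V) = c at *
  omega
end

section
/- Let W be a k-dimensional isotropic subspace of V with dim pr₂(W) = 2 (so necessarily k ≥ 2). Then dim pr₁(W) = k and pr₁(W) is not isotropic: there exist vectors u, v ∈ pr₁(W) with ω(u, v) ≠ 0. -/
/--
If `W` is a `k`-dimensional isotropic subspace of `V = V₁ ⊕ V₂` with `dim pr₂ W = 2`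
(so necessarily `k ≥ 2`), then `dim pr₁ W = k` and `pr₁ W` is not isotropic: there
exist `u, v ∈ pr₁ W` with `ω u v ≠ 0`.
-/
theorem projection_not_isotropic_of_dim_two
    {V : Type*} [AddCommGroup V] [Module ℂ V] [FiniteDimensional ℂ V]
    (ω : V →ₗ[ℂ] V →ₗ[ℂ] ℂ)
    (halt : ∀ v : V, ω v v = 0)
    (hnd : ∀ u : V, (∀ v : V, ω u v = 0) → u = 0)
    (V₁ V₂ : Submodule ℂ V) (hc : IsCompl V₁ V₂)
    (hV₂ : Module.finrank ℂ V₂ = 2)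
    (horth : ∀ v₁ ∈ V₁, ∀ v₂ ∈ V₂, ω v₁ v₂ = 0)
    (k : ℕ) (W : Submodule ℂ V)
    (hW : Module.finrank ℂ W = k)
    (hWiso : ∀ u ∈ W, ∀ v ∈ W, ω u v = 0)
    (hpr₂ : Module.finrank ℂ
        (W.map (V₂.subtype ∘ₗ V₂.linearProjOfIsCompl V₁ hc.symm)) = 2) :
    2 ≤ k ∧
    Module.finrank ℂ (W.map (V₁.subtype ∘ₗ V₁.linearProjOfIsCompl V₂ hc)) = k ∧
    ∃ u ∈ W.map (V₁.subtype ∘ₗ V₁.linearProjOfIsCompl V₂ hc),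
      ∃ v ∈ W.map (V₁.subtype ∘ₗ V₁.linearProjOfIsCompl V₂ hc), ω u v ≠ 0 := by
  have hp : ∀ v, (V₁.subtype ∘ₗ V₁.linearProjOfIsCompl V₂ hc) v ∈ V₁ := fun v => by simp
  have hq : ∀ v, (V₂.subtype ∘ₗ V₂.linearProjOfIsCompl V₁ hc.symm) v ∈ V₂ := fun v => by simp
  have hpq : ∀ v, (V₁.subtype ∘ₗ V₁.linearProjOfIsCompl V₂ hc) v
      + (V₂.subtype ∘ₗ V₂.linearProjOfIsCompl V₁ hc.symm) v = v := fun v => by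
    obtain ⟨a, b, h, -⟩ := Submodule.existsUnique_add_of_isCompl hc v
    subst h
    simp [Submodule.linearProjOfIsCompl]
  generalize (V₁.subtype ∘ₗ V₁.linearProjOfIsCompl V₂ hc) = p at *
  generalize (V₂.subtype ∘ₗ V₂.linearProjOfIsCompl V₁ hc.symm) = q at *
  have hmap : W.map q = V₂ := by
    apply Submodule.eq_of_le_of_finrank_eq
    · rintro _ ⟨w, -, rfl⟩
      exact hq w
    · rw [hpr₂, hV₂]
  have hskew : ∀ u v, ω u v = - ω v u := fun u v => by
    have h := halt (u + v)
    simp only [map_add, LinearMap.add_apply, halt] at h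
    linear_combination h
  have horth' : ∀ v₂ ∈ V₂, ∀ v₁ ∈ V₁, ω v₂ v₁ = 0 := fun a ha b hb => by
    rw [hskew, horth b hb a ha, neg_zero]
  have hsum : ∀ a ∈ W, ∀ b ∈ W, ω (p a) (p b) + ω (q a) (q b) = 0 := fun a ha b hb => by
    have h := hWiso a ha b hb
    rw [← hpq a, ← hpq b] at h
    simp only [map_add, LinearMap.add_apply] at h
    rw [horth _ (hp a) _ (hq b), horth' _ (hq a) _ (hp b)] at h
    linear_combination h
  have hnd₂ : ∀ y ∈ V₂, (∀ b ∈ W, ω y (q b) = 0) → y = 0 := fun y hy h => by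
    apply hnd
    intro v
    have hv : q v ∈ W.map q := hmap ▸ hq v
    obtain ⟨b, hb, hbv⟩ := hv
    rw [← hpq v, map_add, horth' y hy _ (hp v), ← hbv, h b hb, add_zero]
  refine ⟨?_, ?_, ?_⟩
  · rw [← hW, ← hpr₂]
    exact Submodule.finrank_map_le q W
  · rw [← hW]
    have hinj : Function.Injective (p.domRestrict W) := by
      rw [injective_iff_map_eq_zero]
      rintro ⟨w, hw⟩ h
      have h0 : p w = 0 := h
      have hqw : q w = 0 := hnd₂ _ (hq w) fun b hb => by
        have := hsum w hw b hb
        rw [h0] at this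
        simpa using this
      have := hpq w
      rw [h0, hqw, add_zero] at this
      exact Subtype.ext this.symm
    have := LinearMap.finrank_range_of_inj hinj
    rwa [LinearMap.range_domRestrict] at this
  · by_contra! hcon
    have hbot : V₂ = ⊥ := by
      rw [eq_bot_iff]
      intro y hy
      refine hnd₂ y hy fun b hb => ?_
      have hy' : y ∈ W.map q := hmap ▸ hy
      obtain ⟨a, ha, rfl⟩ := hy'
      have := hsum a ha b hb
      rwa [hcon _ ⟨a, ha, rfl⟩ _ ⟨b, hb, rfl⟩, zero_add] at this
    have h0 : Module.finrank ℂ V₂ = 0 := by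
      rw [Submodule.finrank_eq_zero]
      exact hbot
    omega
end

section
/- Let W be a k-dimensional isotropic subspace of V with dim pr₂(W) = 1 and dim pr₁(W) = k − 1. Then W decomposes as W = (W ∩ V₁) ⊕ (W ∩ V₂), with W ∩ V₁ = pr₁(W) (an isotropic subspace of V₁ of dimension k − 1) and W ∩ V₂ = pr₂(W) (a line in V₂). -/
/--
If `W` is a `k`-dimensional isotropic subspace of `V = V₁ ⊕ V₂` with `dim pr₂ W = 1`
and `dim pr₁ W = k − 1`, then `W = (W ∩ V₁) ⊕ (W ∩ V₂)`, with `W ∩ V₁ = pr₁ W` an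
isotropic subspace of `V₁` of dimension `k − 1` and `W ∩ V₂ = pr₂ W` a line in `V₂`.
-/
theorem isotropic_splits_of_dims_one_k_sub_one
    {V : Type*} [AddCommGroup V] [Module ℂ V] [FiniteDimensional ℂ V]
    (ω : V →ₗ[ℂ] V →ₗ[ℂ] ℂ)
    (halt : ∀ v : V, ω v v = 0)
    (hnd : ∀ u : V, (∀ v : V, ω u v = 0) → u = 0)
    (V₁ V₂ : Submodule ℂ V) (hc : IsCompl V₁ V₂)
    (hV₂ : Module.finrank ℂ V₂ = 2)
    (horth : ∀ v₁ ∈ V₁, ∀ v₂ ∈ V₂, ω v₁ v₂ = 0)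
    (k : ℕ) (W : Submodule ℂ V)
    (hW : Module.finrank ℂ W = k)
    (hWiso : ∀ u ∈ W, ∀ v ∈ W, ω u v = 0)
    (hpr₂ : Module.finrank ℂ
        (W.map (V₂.subtype ∘ₗ V₂.linearProjOfIsCompl V₁ hc.symm)) = 1)
    (hpr₁ : Module.finrank ℂ
        (W.map (V₁.subtype ∘ₗ V₁.linearProjOfIsCompl V₂ hc)) = k - 1) :
    (W ⊓ V₁) ⊔ (W ⊓ V₂) = W ∧
    W ⊓ V₁ = W.map (V₁.subtype ∘ₗ V₁.linearProjOfIsCompl V₂ hc) ∧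
    W ⊓ V₂ = W.map (V₂.subtype ∘ₗ V₂.linearProjOfIsCompl V₁ hc.symm) ∧
    Module.finrank ℂ (W ⊓ V₁ : Submodule ℂ V) = k - 1 ∧
    Module.finrank ℂ (W ⊓ V₂ : Submodule ℂ V) = 1 ∧
    (∀ u ∈ W ⊓ V₁, ∀ v ∈ W ⊓ V₁, ω u v = 0) := by
  set p₁ := V₁.subtype ∘ₗ V₁.linearProjOfIsCompl V₂ hc with hp₁
  set p₂ := V₂.subtype ∘ₗ V₂.linearProjOfIsCompl V₁ hc.symm with hp₂
  have hadd : ∀ v, p₁ v + p₂ v = v := fun v => by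
    exact Submodule.projection_add_projection_eq_self hc v
  have m₁ : ∀ v, p₁ v ∈ V₁ := fun v => by simp [hp₁]
  have m₂ : ∀ v, p₂ v ∈ V₂ := fun v => by simp [hp₂]
  have z₁ : ∀ v, p₁ v = 0 ↔ v ∈ V₂ := fun v => by
    rw [hp₁, LinearMap.comp_apply, Submodule.subtype_apply, Submodule.coe_eq_zero]
    exact Submodule.projectionOnto_apply_eq_zero_iff hc
  have z₂ : ∀ v, p₂ v = 0 ↔ v ∈ V₁ := fun v => by
    rw [hp₂, LinearMap.comp_apply, Submodule.subtype_apply, Submodule.coe_eq_zero]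
    exact Submodule.projectionOnto_apply_eq_zero_iff hc.symm
  have hk : 1 ≤ k := by
    rw [← hpr₂, ← hW]
    exact Submodule.finrank_map_le p₂ W
  have hle₁ : W ⊓ V₁ ≤ W.map p₁ := by
    rintro v ⟨hv, hv1⟩
    refine ⟨v, hv, ?_⟩
    have := hadd v
    rwa [(z₂ v).2 hv1, add_zero] at this
  have hle₂ : W ⊓ V₂ ≤ W.map p₂ := by
    rintro v ⟨hv, hv2⟩
    refine ⟨v, hv, ?_⟩
    have := hadd v
    rwa [(z₁ v).2 hv2, zero_add] at this
  have hd : Module.finrank ℂ (W ⊓ V₂ : Submodule ℂ V) = 1 := by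
    have h := LinearMap.finrank_range_add_finrank_ker (p₁.domRestrict W)
    rw [LinearMap.range_domRestrict, hpr₁, hW] at h
    have e : (LinearMap.ker (p₁.domRestrict W)).map W.subtype = W ⊓ V₂ := by
      ext v
      simp [z₁, and_comm]
    rw [← e, Submodule.finrank_map_subtype_eq]
    omega
  have e₂ : W ⊓ V₂ = W.map p₂ :=
    Submodule.eq_of_le_of_finrank_eq hle₂ (hd.trans hpr₂.symm)
  have w₂ : ∀ w ∈ W, p₂ w ∈ W := fun w hw => by
    have : p₂ w ∈ W ⊓ V₂ := e₂ ▸ Submodule.mem_map_of_mem hw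
    exact this.1
  have w₁ : ∀ w ∈ W, p₁ w ∈ W := fun w hw => by
    rw [eq_sub_of_add_eq (hadd w)]
    exact W.sub_mem hw (w₂ w hw)
  have e₁ : W ⊓ V₁ = W.map p₁ := by
    refine le_antisymm hle₁ ?_
    rintro _ ⟨w, hw, rfl⟩
    exact ⟨w₁ w hw, m₁ w⟩
  refine ⟨le_antisymm (sup_le inf_le_left inf_le_left) ?_, e₁, e₂, e₁ ▸ hpr₁, hd,
    fun u hu v hv => hWiso u hu.1 v hv.1⟩
  intro w hw
  rw [← hadd w]
  exact Submodule.add_mem_sup ⟨w₁ w hw, m₁ w⟩ ⟨w₂ w hw, m₂ w⟩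
end

section
/- Fix 1 ≤ s < r. The subgroup of the orthogonal group of ℝ^r generated by the reflections s_β for all β ∈ R_M⁺ equals the subgroup generated by s₁, …, s_{s−1}, s_{s+1}, …, s_r together with the element t_s := s_s s_{s+1} ⋯ s_{r−1} s_r s_{r−1} ⋯ s_{s+1} s_s (which is the reflection with respect to 2α_s + 2α_{s+1} + ⋯ + 2α_{r−1} + α_r = 2e_s). -/
/-- The standard inner product on `ℝ^n`. -/
def ip {n : ℕ} (v w : Fin n → ℝ) : ℝ := ∑ i, v i * w i

/-- The orthogonal reflection `v ↦ v − (2⟨v,β⟩/⟨β,β⟩)β` with respect to a vector `β`. -/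
noncomputable def reflFun {n : ℕ} (β : Fin n → ℝ) : (Fin n → ℝ) → (Fin n → ℝ) :=
  fun v => v - (2 * ip v β / ip β β) • β

lemma ip_sub_smul {n : ℕ} (v β : Fin n → ℝ) (c : ℝ) :
    ip (v - c • β) β = ip v β - c * ip β β := by
  simp only [ip, Pi.sub_apply, Pi.smul_apply, smul_eq_mul, sub_mul,
    Finset.sum_sub_distrib, Finset.mul_sum, mul_assoc]

lemma reflFun_involutive {n : ℕ} (β : Fin n → ℝ) : Function.Involutive (reflFun β) := by
  intro v
  by_cases h : ip β β = 0
  · simp [reflFun, h]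
  · simp only [reflFun]
    rw [ip_sub_smul, sub_sub, ← add_smul]
    have hc : 2 * ip v β / ip β β + 2 * (ip v β - 2 * ip v β / ip β β * ip β β) / ip β β = 0 := by
      field_simp
      ring
    rw [hc, zero_smul, sub_zero]

/-- The orthogonal reflection with respect to `β`, as a permutation of `ℝ^n`. -/
noncomputable def reflPerm {n : ℕ} (β : Fin n → ℝ) : Equiv.Perm (Fin n → ℝ) :=
  Function.Involutive.toPerm (reflFun β) (reflFun_involutive β)

/-- The standard basis vector `e_i` of `ℝ^r` (1-based index). -/
def sv (r i : ℕ) : Fin r → ℝ := fun j => if (j : ℕ) + 1 = i then 1 else 0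

/-- The simple roots of `Sp(2r)`: `α_i = e_i − e_{i+1}` for `1 ≤ i ≤ r−1`, `α_r = 2e_r`. -/
def sroot (r i : ℕ) : Fin r → ℝ := if i = r then (2 : ℝ) • sv r r else sv r i - sv r (i + 1)

/-- The positive roots of `Sp(2r)`. -/
def Rpos (r : ℕ) : Set (Fin r → ℝ) :=
  {β | ∃ i j, 1 ≤ i ∧ i < j ∧ j ≤ r ∧ (β = sv r i - sv r j ∨ β = sv r i + sv r j)} ∪
  {β | ∃ i, 1 ≤ i ∧ i ≤ r ∧ β = (2 : ℝ) • sv r i}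

/-- The positive roots of the subgroup `M = Sp(2s) × Sp(2(r−s))` of `Sp(2r)`. -/
def RMpos (r s : ℕ) : Set (Fin r → ℝ) :=
  {β | ∃ i j, 1 ≤ i ∧ i < j ∧ j ≤ s ∧ (β = sv r i - sv r j ∨ β = sv r i + sv r j)} ∪
  {β | ∃ i, 1 ≤ i ∧ i ≤ s ∧ β = (2 : ℝ) • sv r i} ∪
  {β | ∃ i j, s < i ∧ i < j ∧ j ≤ r ∧ (β = sv r i - sv r j ∨ β = sv r i + sv r j)} ∪
  {β | ∃ i, s < i ∧ i ≤ r ∧ β = (2 : ℝ) • sv r i}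

lemma ip_comm' {n : ℕ} (v w : Fin n → ℝ) : ip v w = ip w v := by
  simp only [ip, mul_comm]

lemma ip_lin_left {n : ℕ} (v w β : Fin n → ℝ) (c : ℝ) :
    ip (v - c • w) β = ip v β - c * ip w β := by
  simp only [ip, Pi.sub_apply, Pi.smul_apply, smul_eq_mul, sub_mul,
    Finset.sum_sub_distrib, Finset.mul_sum, mul_assoc]

lemma ip_lin_right {n : ℕ} (v w β : Fin n → ℝ) (c : ℝ) :
    ip β (v - c • w) = ip β v - c * ip β w := by
  rw [ip_comm', ip_lin_left, ip_comm' v, ip_comm' w]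

lemma reflFun_lin {n : ℕ} (β v w : Fin n → ℝ) (c : ℝ) :
    reflFun β (v - c • w) = reflFun β v - c • reflFun β w := by
  simp only [reflFun, ip_lin_left]
  funext i
  simp only [Pi.sub_apply, Pi.smul_apply, smul_eq_mul]
  ring

lemma ip_reflFun {n : ℕ} (β v w : Fin n → ℝ) :
    ip (reflFun β v) (reflFun β w) = ip v w := by
  by_cases h : ip β β = 0
  · simp [reflFun, h]
  · simp only [reflFun, ip_lin_left, ip_lin_right]
    rw [ip_comm' β w]
    field_simp
    ring

lemma refl_conj {n : ℕ} (β γ : Fin n → ℝ) :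
    reflPerm β * reflPerm γ * reflPerm β = reflPerm (reflFun β γ) := by
  ext1 v
  change reflFun β (reflFun γ (reflFun β v)) = reflFun (reflFun β γ) v
  have h1 : ip (reflFun β v) γ = ip v (reflFun β γ) := by
    rw [← ip_reflFun β (reflFun β v) γ, reflFun_involutive β v]
  have h2 : reflFun γ (reflFun β v) = reflFun β v - (2 * ip (reflFun β v) γ / ip γ γ) • γ := rfl
  rw [h2, reflFun_lin, reflFun_involutive β v, h1]
  conv_rhs => rw [reflFun, ip_reflFun]

lemma ip_sv {r i : ℕ} (hi : 1 ≤ i) (hir : i ≤ r) (v : Fin r → ℝ) :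
    ip v (sv r i) = v ⟨i - 1, by omega⟩ := by
  unfold ip sv
  rw [Finset.sum_eq_single ⟨i - 1, by omega⟩]
  · simp; omega
  · intro b _ hb
    have : (b : ℕ) + 1 ≠ i := by
      intro h; apply hb; ext; simp; omega
    simp [this]
  · simp

lemma reflFun_diff {r i j : ℕ} (hi : 1 ≤ i) (hir : i ≤ r) (hj : 1 ≤ j) (hjr : j ≤ r)
    (hij : i ≠ j) (v : Fin r → ℝ) :
    reflFun (sv r i - sv r j) v =
      v - (v ⟨i - 1, by omega⟩ - v ⟨j - 1, by omega⟩) • (sv r i - sv r j) := by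
  have h : ∀ w : Fin r → ℝ, ip w (sv r i - sv r j) =
      w ⟨i - 1, by omega⟩ - w ⟨j - 1, by omega⟩ := by
    intro w
    have := ip_lin_right (sv r i) (sv r j) w 1
    rw [one_smul] at this
    rw [this, ip_sv hi hir, ip_sv hj hjr, one_mul]
  unfold reflFun
  rw [h, h]
  have a1 : i - 1 + 1 = i := by omega
  have a2 : j - 1 + 1 = j := by omega
  congr 2
  simp [sv, a1, a2, hij, hij.symm]
  ring

lemma reflFun_two {r i : ℕ} (hi : 1 ≤ i) (hir : i ≤ r) (v : Fin r → ℝ) :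
    reflFun ((2 : ℝ) • sv r i) v = v - (2 * v ⟨i - 1, by omega⟩) • sv r i := by
  have h : ∀ w : Fin r → ℝ, ip w ((2 : ℝ) • sv r i) = 2 * w ⟨i - 1, by omega⟩ := by
    intro w
    rw [← ip_sv hi hir w]
    simp only [ip, Pi.smul_apply, smul_eq_mul, Finset.mul_sum]
    exact Finset.sum_congr rfl fun _ _ => by ring
  unfold reflFun
  rw [h, h, smul_smul]
  have a1 : i - 1 + 1 = i := by omega
  congr 2
  simp [sv, a1]
  ring

-- conj of e_i - e_j by e_j - e_k
lemma conj1 {r i j k : ℕ} (hi : 1 ≤ i) (hij : i < j) (hjk : j < k) (hk : k ≤ r) :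
    reflFun (sv r j - sv r k) (sv r i - sv r j) = sv r i - sv r k := by
  rw [reflFun_diff (by omega) (by omega) (by omega) (by omega) (by omega)]
  have a1 : j - 1 + 1 = j := by omega
  have a2 : k - 1 + 1 = k := by omega
  have n1 : j ≠ i := by omega
  have n2 : k ≠ i := by omega
  have n3 : k ≠ j := by omega
  simp [sv, a1, a2, n1, n2, n3]

lemma conj2 {r i j : ℕ} (hi : 1 ≤ i) (hij : i < j) (hj : j ≤ r) :
    reflFun (sv r i - sv r j) ((2 : ℝ) • sv r j) = (2 : ℝ) • sv r i := by
  rw [reflFun_diff (by omega) (by omega) (by omega) (by omega) (by omega)]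
  have a1 : j - 1 + 1 = j := by omega
  have a2 : i - 1 + 1 = i := by omega
  have n1 : i ≠ j := by omega
  funext x
  simp [sv, a1, a2, n1]
  split_ifs <;> norm_num

lemma conj3 {r i j : ℕ} (hi : 1 ≤ i) (hij : i < j) (hj : j ≤ r) :
    reflFun ((2 : ℝ) • sv r j) (sv r i - sv r j) = sv r i + sv r j := by
  rw [reflFun_two (by omega) (by omega)]
  have a1 : j - 1 + 1 = j := by omega
  have n1 : j ≠ i := by omega
  funext x
  simp [sv, a1, n1]
  split_ifs <;> norm_num

lemma conj_mem {n : ℕ} {H : Subgroup (Equiv.Perm (Fin n → ℝ))} {β γ δ : Fin n → ℝ}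
    (hβ : reflPerm β ∈ H) (hγ : reflPerm γ ∈ H) (h : reflFun β γ = δ) : reflPerm δ ∈ H := by
  rw [← h, ← refl_conj]
  exact H.mul_mem (H.mul_mem hβ hγ) hβ

lemma block {r a b : ℕ} (hb : b ≤ r) {H : Subgroup (Equiv.Perm (Fin r → ℝ))}
    (h1 : ∀ i, a < i → i < b → reflPerm (sv r i - sv r (i + 1)) ∈ H)
    (h2 : reflPerm ((2 : ℝ) • sv r b) ∈ H) :
    (∀ i, a < i → i ≤ b → reflPerm ((2 : ℝ) • sv r i) ∈ H) ∧
    (∀ i j, a < i → i < j → j ≤ b →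
      reflPerm (sv r i - sv r j) ∈ H ∧ reflPerm (sv r i + sv r j) ∈ H) := by
  have D : ∀ i j, a < i → i < j → j ≤ b → reflPerm (sv r i - sv r j) ∈ H := by
    intro i j hi hij
    induction j, hij using Nat.le_induction with
    | base => intro h; exact h1 i hi (by omega)
    | succ j hj ih =>
      intro h
      exact conj_mem (h1 j (by omega) (by omega)) (ih (by omega))
        (conj1 (by omega) (by omega) (by omega) (by omega))
  have T : ∀ i, a < i → i ≤ b → reflPerm ((2 : ℝ) • sv r i) ∈ H := by
    intro i hi hib
    rcases hib.eq_or_lt with rfl | hlt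
    · exact h2
    · exact conj_mem (D i b hi hlt le_rfl) h2 (conj2 (by omega) hlt hb)
  exact ⟨T, fun i j hi hij hj => ⟨D i j hi hij hj,
    conj_mem (T j (by omega) hj) (D i j hi hij hj) (conj3 (by omega) hij (by omega))⟩⟩

lemma ts_eq (r m s : ℕ) (hs : 1 ≤ s) (h : s + m = r) :
    ((List.range' s m ++ r :: (List.range' s m).reverse).map
      (fun i => reflPerm (sroot r i))).prod = reflPerm ((2 : ℝ) • sv r s) := by
  induction m generalizing s with
  | zero =>
    have : s = r := by omega
    subst this
    simp [sroot]
  | succ m ih =>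
    have e := ih (s + 1) (by omega) (by omega)
    rw [← conj2 (r := r) (i := s) (j := s + 1) hs (by omega) (by omega), ← refl_conj, ← e]
    have hsr : sroot r s = sv r s - sv r (s + 1) := by
      unfold sroot
      rw [if_neg (by omega)]
    rw [List.range'_succ]
    simp [hsr, mul_assoc]

/--
For `1 ≤ s < r`, the group generated by the reflections `s_β` for `β ∈ R_M⁺`
(the positive roots of `M = Sp(2s) × Sp(2(r−s))`) equals the group generated by the
simple reflections `s₁, …, s_{s−1}, s_{s+1}, …, s_r` of `Sp(2r)` together with
`t_s = s_s s_{s+1} ⋯ s_{r−1} s_r s_{r−1} ⋯ s_{s+1} s_s`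
(the reflection with respect to `2α_s + ⋯ + 2α_{r−1} + α_r = 2e_s`).
-/
theorem weyl_subgroup_generators
    (r s : ℕ) (hs : 1 ≤ s) (hsr : s < r) :
    Subgroup.closure ((fun β => reflPerm β) '' RMpos r s) =
    Subgroup.closure
      ({g : Equiv.Perm (Fin r → ℝ) | ∃ i, 1 ≤ i ∧ i ≤ r ∧ i ≠ s ∧ g = reflPerm (sroot r i)} ∪
       {((List.range' s (r - s) ++ r :: (List.range' s (r - s)).reverse).map
          (fun i => reflPerm (sroot r i))).prod}) := by
  have hsroot : ∀ i, i < r → sroot r i = sv r i - sv r (i + 1) := by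
    intro i hi
    unfold sroot
    rw [if_neg (by omega)]
  have hr : sroot r r = (2 : ℝ) • sv r r := by simp [sroot]
  rw [ts_eq r (r - s) s hs (by omega)]
  apply le_antisymm
  · rw [Subgroup.closure_le]
    set H := Subgroup.closure
      ({g : Equiv.Perm (Fin r → ℝ) | ∃ i, 1 ≤ i ∧ i ≤ r ∧ i ≠ s ∧ g = reflPerm (sroot r i)} ∪
       {reflPerm ((2 : ℝ) • sv r s)}) with hH
    have g1 : ∀ i, 1 ≤ i → i < r → i ≠ s → reflPerm (sv r i - sv r (i + 1)) ∈ H := by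
      intro i h1 h2 h3
      exact Subgroup.subset_closure (Or.inl ⟨i, h1, by omega, h3, by rw [hsroot i h2]⟩)
    have g2 : reflPerm ((2 : ℝ) • sv r r) ∈ H :=
      Subgroup.subset_closure (Or.inl ⟨r, by omega, le_rfl, by omega, by rw [hr]⟩)
    have g3 : reflPerm ((2 : ℝ) • sv r s) ∈ H := Subgroup.subset_closure (Or.inr rfl)
    obtain ⟨A1, A2⟩ := block (a := 0) (b := s) hsr.le
      (fun i hi hi' => g1 i (by omega) (by omega) (by omega)) g3
    obtain ⟨B1, B2⟩ := block (a := s) (b := r) le_rfl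
      (fun i hi hi' => g1 i (by omega) (by omega) (by omega)) g2
    rintro _ ⟨β, hβ, rfl⟩
    rcases hβ with ((⟨i, j, hi, hij, hj, rfl | rfl⟩ | ⟨i, hi, hi', rfl⟩) |
      ⟨i, j, hi, hij, hj, rfl | rfl⟩) | ⟨i, hi, hi', rfl⟩
    · exact (A2 i j hi hij hj).1
    · exact (A2 i j hi hij hj).2
    · exact A1 i hi hi'
    · exact (B2 i j hi hij hj).1
    · exact (B2 i j hi hij hj).2
    · exact B1 i hi hi'
  · rw [Subgroup.closure_le]
    rintro g (⟨i, h1, h2, h3, rfl⟩ | hg)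
    · apply Subgroup.subset_closure
      refine ⟨_, ?_, rfl⟩
      rcases h2.eq_or_lt with rfl | hlt
      · rw [hr]
        exact Or.inr ⟨i, hsr, le_rfl, rfl⟩
      · rw [hsroot i hlt]
        rcases lt_or_gt_of_ne h3 with h | h
        · exact Or.inl (Or.inl (Or.inl ⟨i, i + 1, h1, by omega, by omega, Or.inl rfl⟩))
        · exact Or.inl (Or.inr ⟨i, i + 1, h, by omega, by omega, Or.inl rfl⟩)
    · rw [Set.mem_singleton_iff] at hg
      subst hg
      exact Subgroup.subset_closure ⟨_, Or.inl (Or.inl (Or.inr ⟨s, hs, le_rfl, rfl⟩)), rfl⟩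
end

section
/- Fix 1 ≤ k ≤ s < r. The simple roots of M are β₁ = α₁, …, β_{s−1} = α_{s−1}, β_s = 2e_s, β_{s+1} = α_{s+1}, …, β_r = α_r. Let w be an element of the subgroup W_M of the orthogonal group of ℝ^r generated by the reflections s_β for β ∈ R_M⁺. Suppose that w(β_i) ∈ R⁺ for every index i ≠ k. Then w(α_i) ∈ R⁺ for every index i ≠ k. (This is the statement that the inclusion of Weyl groups W_M ⊆ W carries minimal-length coset representatives for the maximal parabolic of M omitting β_k to minimal-length coset representatives for the maximal parabolic of Sp(2r) omitting α_k.) -/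
/-- The simple roots `β_i` of `M = Sp(2s) × Sp(2(r−s))`:
`β_i = α_i` for `i ≠ s`, and `β_s = 2e_s`. -/
def Mroot (r s i : ℕ) : Fin r → ℝ := if i = s then (2 : ℝ) • sv r s else sroot r i

lemma ip_add_r {n : ℕ} (v a b : Fin n → ℝ) : ip v (a + b) = ip v a + ip v b := by
  simp [ip, mul_add, Finset.sum_add_distrib]

lemma ip_smul_r {n : ℕ} (v a : Fin n → ℝ) (c : ℝ) : ip v (c • a) = c * ip v a := by
  simp only [ip, Pi.smul_apply, smul_eq_mul, Finset.mul_sum]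
  exact Finset.sum_congr rfl fun i _ => by ring

lemma ip_add_l {n : ℕ} (v a b : Fin n → ℝ) : ip (a + b) v = ip a v + ip b v := by
  simp [ip, add_mul, Finset.sum_add_distrib]

lemma ip_smul_l {n : ℕ} (v a : Fin n → ℝ) (c : ℝ) : ip (c • a) v = c * ip a v := by
  simp only [ip, Pi.smul_apply, smul_eq_mul, Finset.mul_sum]
  exact Finset.sum_congr rfl fun i _ => by ring

lemma ip_sv_s7 {r i j : ℕ} (hi : 1 ≤ i) (hir : i ≤ r) :
    ip (sv r i) (sv r j) = if i = j then 1 else 0 := by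
  unfold ip sv
  rw [Finset.sum_eq_single (⟨i - 1, by omega⟩ : Fin r)]
  · have : i - 1 + 1 = i := by omega
    simp [this]
  · intro b _ hb
    have : (b : ℕ) + 1 ≠ i := fun h => hb (Fin.ext (by simp; omega))
    simp [this]
  · simp

lemma refl_add {n : ℕ} (β u v : Fin n → ℝ) : reflFun β (u + v) = reflFun β u + reflFun β v := by
  unfold reflFun
  rw [ip_add_l]
  module

lemma refl_smul {n : ℕ} (β u : Fin n → ℝ) (c : ℝ) : reflFun β (c • u) = c • reflFun β u := by
  unfold reflFun
  rw [ip_smul_l]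
  module

def blk (r c d : ℕ) : Set (Fin r → ℝ) :=
  {v | ∃ j, c < j ∧ j ≤ d ∧ ∃ ε : ℝ, (ε = 1 ∨ ε = -1) ∧ v = ε • sv r j}

lemma refl_short {r i j c d : ℕ} (ε : ℝ) (hε : ε = 1 ∨ ε = -1) (hi : 1 ≤ i) (hir : i ≤ r)
    (hj : 1 ≤ j) (hjr : j ≤ r) (hij : i ≠ j) (hdr : d ≤ r)
    (h : (c < i ∧ i ≤ d) ↔ (c < j ∧ j ≤ d)) (v : Fin r → ℝ) (hv : v ∈ blk r c d) :
    reflFun (sv r i + ε • sv r j) v ∈ blk r c d := by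
  obtain ⟨l, hl, hld, δ, hδ, rfl⟩ := hv
  rw [refl_smul]
  have hεε : ε * ε = 1 := by rcases hε with rfl | rfl <;> norm_num
  have hδε : -(δ * ε) = 1 ∨ -(δ * ε) = -1 := by
    rcases hε with rfl | rfl <;> rcases hδ with rfl | rfl <;> norm_num
  have hbb : ip (sv r i + ε • sv r j) (sv r i + ε • sv r j) = 2 := by
    simp only [ip_add_l, ip_add_r, ip_smul_l, ip_smul_r, ip_sv_s7 hi hir, ip_sv_s7 hj hjr,
      if_neg hij, if_neg hij.symm, if_true]
    linarith
  have hlb : ip (sv r l) (sv r i + ε • sv r j) =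
      (if l = i then 1 else 0) + ε * (if l = j then 1 else 0) := by
    simp only [ip_add_r, ip_smul_r, ip_sv_s7 (show 1 ≤ l by omega) (hld.trans hdr)]
  unfold reflFun
  rw [hbb, hlb]
  by_cases h1 : l = i
  · subst h1
    refine ⟨j, (h.1 ⟨hl, hld⟩).1, (h.1 ⟨hl, hld⟩).2, _, hδε, ?_⟩
    simp only [if_neg hij, if_true]
    module
  · by_cases h2 : l = j
    · subst h2
      refine ⟨i, (h.2 ⟨hl, hld⟩).1, (h.2 ⟨hl, hld⟩).2, _, hδε, ?_⟩
      simp only [if_neg h1, if_true]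
      have : sv r l = (ε * ε) • sv r l := by rw [hεε, one_smul]
      nth_rewrite 1 [this]
      module
    · refine ⟨l, hl, hld, δ, hδ, ?_⟩
      simp [h1, h2]

lemma refl_long {r i c d : ℕ} (hi : 1 ≤ i) (hir : i ≤ r) (hdr : d ≤ r)
    (v : Fin r → ℝ) (hv : v ∈ blk r c d) :
    reflFun ((2 : ℝ) • sv r i) v ∈ blk r c d := by
  obtain ⟨l, hl, hld, δ, hδ, rfl⟩ := hv
  rw [refl_smul]
  unfold reflFun
  simp only [ip_smul_l, ip_smul_r, ip_sv_s7 hi hir, ip_sv_s7 (show 1 ≤ l by omega) (hld.trans hdr)]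
  by_cases h1 : l = i
  · subst h1
    refine ⟨l, hl, hld, -δ, by rcases hδ with rfl | rfl <;> simp, ?_⟩
    norm_num
    module
  · exact ⟨l, hl, hld, δ, hδ, by simp [h1]⟩

lemma refl_blk {r s c d : ℕ} (hsr : s < r) (hcd : (c = 0 ∧ d = s) ∨ (c = s ∧ d = r))
    (β : Fin r → ℝ) (hβ : β ∈ RMpos r s) (v : Fin r → ℝ) (hv : v ∈ blk r c d) :
    reflFun β v ∈ blk r c d := by
  have hm : ∀ i j : ℕ, sv r i - sv r j = sv r i + (-1 : ℝ) • sv r j := fun i j => by module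
  have hp : ∀ i j : ℕ, sv r i + sv r j = sv r i + (1 : ℝ) • sv r j := fun i j => by module
  rcases hβ with ((⟨i, j, h1, h2, h3, rfl | rfl⟩ | ⟨i, h1, h2, rfl⟩) |
    ⟨i, j, h1, h2, h3, rfl | rfl⟩) | ⟨i, h1, h2, rfl⟩
  · rw [hm]
    exact refl_short _ (by simp) (by omega) (by omega) (by omega) (by omega) (by omega)
      (by omega) (by omega) v hv
  · rw [hp]
    exact refl_short _ (by simp) (by omega) (by omega) (by omega) (by omega) (by omega)
      (by omega) (by omega) v hv
  · exact refl_long (by omega) (by omega) (by omega) v hv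
  · rw [hm]
    exact refl_short _ (by simp) (by omega) (by omega) (by omega) (by omega) (by omega)
      (by omega) (by omega) v hv
  · rw [hp]
    exact refl_short _ (by simp) (by omega) (by omega) (by omega) (by omega) (by omega)
      (by omega) (by omega) v hv
  · exact refl_long (by omega) (by omega) (by omega) v hv

lemma W_inv {r s : ℕ} (hsr : s < r) (w : Equiv.Perm (Fin r → ℝ))
    (hw : w ∈ Subgroup.closure ((fun β => reflPerm β) '' RMpos r s)) :
    (∀ u v, w (u + v) = w u + w v) ∧ (∀ (c : ℝ) u, w (c • u) = c • w u) ∧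
    (∀ c d, ((c = 0 ∧ d = s) ∨ (c = s ∧ d = r)) → ∀ v, v ∈ blk r c d ↔ w v ∈ blk r c d) := by
  induction hw using Subgroup.closure_induction with
  | mem x hx =>
    obtain ⟨β, hβ, rfl⟩ := hx
    refine ⟨refl_add β, fun c u => refl_smul β u c, fun c d hcd v =>
      ⟨refl_blk hsr hcd β hβ v, fun h => ?_⟩⟩
    have := refl_blk hsr hcd β hβ _ h
    have h2 : reflFun β (reflPerm β v) = v := reflFun_involutive β v
    rwa [h2] at this
  | one => simp
  | mul x y _ _ hx hy =>
    refine ⟨fun u v => ?_, fun c u => ?_, fun c d hcd v => ?_⟩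
    · simp [hx.1, hy.1]
    · simp [hx.2.1, hy.2.1]
    · rw [hy.2.2 c d hcd, hx.2.2 c d hcd]; rfl
  | inv x _ hx =>
    refine ⟨fun u v => x.injective ?_, fun c u => x.injective ?_, fun c d hcd v => ?_⟩
    · simp [hx.1]
    · simp [hx.2.1]
    · rw [hx.2.2 c d hcd (x⁻¹ v)]; simp

lemma not_pos {r j : ℕ} : (2 : ℝ) • ((-1 : ℝ) • sv r j) ∉ Rpos r := by
  rintro (⟨i, l, h1, h2, h3, h | h⟩ | ⟨i, h1, h2, h⟩) <;>
  · have := congrFun h ⟨i - 1, by omega⟩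
    have e : i - 1 + 1 = i := by omega
    simp only [sv, Pi.smul_apply, Pi.sub_apply, Pi.add_apply, smul_eq_mul, e] at this
    split_ifs at this <;> first | omega | (norm_num at this)

/--
Fix `1 ≤ k ≤ s < r`.  If `w ∈ W_M` sends every simple root `β_i` of `M` with `i ≠ k`
to a positive root, then `w` sends every simple root `α_i` of `Sp(2r)` with `i ≠ k`
to a positive root; i.e. the inclusion `W_M ⊆ W` carries minimal-length coset
representatives for the maximal parabolic of `M` omitting `β_k` to minimal-length
coset representatives for the maximal parabolic of `Sp(2r)` omitting `α_k`.
-/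
theorem minimal_representatives_included
    (r s k : ℕ) (hk : 1 ≤ k) (hks : k ≤ s) (hsr : s < r)
    (w : Equiv.Perm (Fin r → ℝ))
    (hw : w ∈ Subgroup.closure ((fun β => reflPerm β) '' RMpos r s))
    (hmin : ∀ i, 1 ≤ i → i ≤ r → i ≠ k → w (Mroot r s i) ∈ Rpos r) :
    ∀ i, 1 ≤ i → i ≤ r → i ≠ k → w (sroot r i) ∈ Rpos r := by
  intro i h1 h2 h3
  by_cases his : i = s
  · subst his
    obtain ⟨hadd, hsm, hb⟩ := W_inv hsr w hw
    have hp := hmin i h1 h2 h3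
    rw [Mroot, if_pos rfl, hsm] at hp
    obtain ⟨a, ha, hai, ε, hε, he⟩ := (hb 0 i (Or.inl ⟨rfl, rfl⟩) (sv r i)).1
      ⟨i, by omega, le_rfl, 1, Or.inl rfl, by simp⟩
    obtain ⟨b, hib, hbr, δ, hδ, hd⟩ := (hb i r (Or.inr ⟨rfl, rfl⟩) (sv r (i + 1))).1
      ⟨i + 1, by omega, by omega, 1, Or.inl rfl, by simp⟩
    have hroot : sroot r i = sv r i + (-1 : ℝ) • sv r (i + 1) := by
      rw [sroot, if_neg (by omega)]
      module
    rw [he] at hp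
    rcases hε with rfl | rfl
    · rw [hroot, hadd, hsm, he, hd]
      left
      refine ⟨a, b, by omega, by omega, hbr, ?_⟩
      rcases hδ with rfl | rfl
      · left; module
      · right; module
    · exact absurd hp not_pos
  · have := hmin i h1 h2 h3
    rwa [Mroot, if_neg his] at this
end

section
/- Let 1 ≤ s < r and let I^M be a k-element subset of {1, …, 2s} with i + j ≠ 2s + 1 for all i, j ∈ I^M, and let I ⊆ {1, …, 2r} be the image of I^M under the map sending i to i if i ≤ s and to i + 2(r−s) if i > s. Then D_r(I) − D_s(I^M) = 4(r−s)·|I^M > s|, where |I^M > s| = #{i ∈ I^M : i > s}. (Equivalently, the dimension of the Schubert cell of IG(k, 2r) indexed by I exceeds the dimension of the Schubert cell of IG(k, 2s) indexed by I^M by 2(r−s)·|I^M > s|.) -/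
/-- `|I > m|`: the number of elements of `I` that are greater than `m`. -/
def gtCount (I : Finset ℕ) (m : ℕ) : ℕ := (I.filter fun i => m < i).card

/-- `|I > J|`: the number of pairs `(i, j) ∈ I × J` with `i > j`. -/
def gtPairs (I J : Finset ℕ) : ℕ := ((I ×ˢ J).filter fun p => p.2 < p.1).card

/-- `D_r(I) = 2|I > Ĩ| + |I > Ī| + |I > r|`, where `Ī = {2r+1−i : i ∈ I}` and
`Ĩ = {1, …, 2r} \ (I ∪ Ī)`; when `i + j ≠ 2r+1` for all `i, j ∈ I`, the quantity
`D_r(I)/2` is the dimension of the Schubert cell of `IG(k, 2r)` indexed by `I`. -/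
def Dfun (r : ℕ) (I : Finset ℕ) : ℕ :=
  2 * gtPairs I ((Finset.Icc 1 (2 * r)) \ (I ∪ I.image fun i => 2 * r + 1 - i)) +
    gtPairs I (I.image fun i => 2 * r + 1 - i) + gtCount I r

theorem gtPairs_image_aux (f : ℕ → ℕ) (hf : StrictMono f) (A B : Finset ℕ) :
    gtPairs (A.image f) (B.image f) = gtPairs A B := by
  unfold gtPairs
  symm
  apply Finset.card_bij (fun p _ => (f p.1, f p.2))
  · intro p hp
    simp only [Finset.mem_filter, Finset.mem_product] at hp ⊢
    exact ⟨⟨Finset.mem_image_of_mem f hp.1.1, Finset.mem_image_of_mem f hp.1.2⟩, hf hp.2⟩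
  · rintro ⟨a, b⟩ _ ⟨c, d⟩ _ h
    simp only [Prod.mk.injEq] at h ⊢
    exact ⟨hf.injective h.1, hf.injective h.2⟩
  · rintro ⟨a, b⟩ h
    simp only [Finset.mem_filter, Finset.mem_product, Finset.mem_image] at h
    obtain ⟨⟨⟨x, hx, rfl⟩, ⟨y, hy, rfl⟩⟩, h⟩ := h
    refine ⟨(x, y), ?_, rfl⟩
    simp only [Finset.mem_filter, Finset.mem_product]
    exact ⟨⟨hx, hy⟩, hf.lt_iff_lt.1 h⟩

theorem gtPairs_union_aux (A B C : Finset ℕ) (h : Disjoint B C) :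
    gtPairs A (B ∪ C) = gtPairs A B + gtPairs A C := by
  unfold gtPairs
  rw [Finset.product_union, Finset.filter_union, Finset.card_union_of_disjoint]
  apply Finset.disjoint_filter_filter
  exact Finset.disjoint_product.2 (Or.inr h)

theorem dimension_jump_of_schubert_cells
    (r s k : ℕ) (hs : 1 ≤ s) (hsr : s < r)
    (IM : Finset ℕ) (hsub : IM ⊆ Finset.Icc 1 (2 * s)) (hcard : IM.card = k)
    (hiso : ∀ i ∈ IM, ∀ j ∈ IM, i + j ≠ 2 * s + 1) :
    Dfun r (IM.image fun i => if i ≤ s then i else i + 2 * (r - s)) =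
      Dfun s IM + 4 * (r - s) * gtCount IM s := by
  obtain ⟨d, rfl⟩ : ∃ d, r = s + d := ⟨r - s, by omega⟩
  have hd : s + d - s = d := by omega
  rw [hd]
  set f : ℕ → ℕ := fun i => if i ≤ s then i else i + 2 * d with hfdef
  have hfv : ∀ i, (i ≤ s ∧ f i = i) ∨ (s < i ∧ f i = i + 2 * d) := by
    intro i
    simp only [hfdef]
    split_ifs <;> omega
  have hf : StrictMono f := by
    intro a b hab
    have := hfv a
    have := hfv b
    omega
  have hb : ∀ i ∈ IM, 1 ≤ i ∧ i ≤ 2 * s := fun i hi => Finset.mem_Icc.1 (hsub hi)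
  have hbar : (IM.image f).image (fun i => 2 * (s + d) + 1 - i) =
      (IM.image fun i => 2 * s + 1 - i).image f := by
    rw [Finset.image_image, Finset.image_image]
    apply Finset.image_congr
    intro i hi
    have := hb i hi
    have := hfv i
    have := hfv (2 * s + 1 - i)
    simp only [Function.comp]
    omega
  have htil : Finset.Icc 1 (2 * (s + d)) \ (IM.image f ∪ (IM.image fun i => 2 * s + 1 - i).image f)
      = (Finset.Icc 1 (2 * s) \ (IM ∪ IM.image fun i => 2 * s + 1 - i)).image f ∪
        Finset.Ioc s (s + 2 * d) := by
    rw [← Finset.image_union]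
    have hU : IM ∪ IM.image (fun i => 2 * s + 1 - i) ⊆ Finset.Icc 1 (2 * s) := by
      intro x hx
      simp only [Finset.mem_union, Finset.mem_image] at hx
      rcases hx with hx | ⟨i, hi, rfl⟩
      · exact hsub hx
      · have := hb i hi
        rw [Finset.mem_Icc]; omega
    generalize IM ∪ IM.image (fun i => 2 * s + 1 - i) = U at hU
    rw [Finset.image_sdiff _ _ hf.injective]
    ext x
    simp only [Finset.mem_union, Finset.mem_sdiff, Finset.mem_Icc, Finset.mem_Ioc]
    have h1 : x ∈ (Finset.Icc 1 (2 * s)).image f ↔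
        (1 ≤ x ∧ x ≤ 2 * (s + d)) ∧ ¬ (s < x ∧ x ≤ s + 2 * d) := by
      simp only [Finset.mem_image, Finset.mem_Icc]
      constructor
      · rintro ⟨i, hi, rfl⟩
        have := hfv i
        omega
      · intro h
        by_cases hx : x ≤ s
        · refine ⟨x, by omega, ?_⟩
          have := hfv x
          omega
        · refine ⟨x - 2 * d, by omega, ?_⟩
          have := hfv (x - 2 * d)
          omega
    have h2 : x ∈ U.image f → x ∈ (Finset.Icc 1 (2 * s)).image f :=
      fun h => Finset.image_subset_image hU h
    rw [h1] at h2 ⊢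
    have h3 : (s < x ∧ x ≤ s + 2 * d) → (1 ≤ x ∧ x ≤ 2 * (s + d)) := by omega
    generalize (s < x ∧ x ≤ s + 2 * d) = P at *
    generalize (1 ≤ x ∧ x ≤ 2 * (s + d)) = Q at *
    tauto
  have hdisj : Disjoint ((Finset.Icc 1 (2 * s) \ (IM ∪ IM.image fun i => 2 * s + 1 - i)).image f)
      (Finset.Ioc s (s + 2 * d)) := by
    rw [Finset.disjoint_left]
    intro x hx hx'
    obtain ⟨i, _, rfl⟩ := Finset.mem_image.1 hx
    rw [Finset.mem_Ioc] at hx'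
    have := hfv i
    omega
  have hcnt : gtCount (IM.image f) (s + d) = gtCount IM s := by
    unfold gtCount
    rw [Finset.filter_image, Finset.card_image_of_injective _ hf.injective]
    congr 1
    apply Finset.filter_congr
    intro i _
    have := hfv i
    omega
  have hgap : gtPairs (IM.image f) (Finset.Ioc s (s + 2 * d)) = gtCount IM s * (2 * d) := by
    have : ((IM.image f) ×ˢ Finset.Ioc s (s + 2 * d)).filter (fun p => p.2 < p.1) =
        ((IM.filter fun i => s < i).image f) ×ˢ Finset.Ioc s (s + 2 * d) := by
      ext ⟨a, b⟩
      simp only [Finset.mem_filter, Finset.mem_product, Finset.mem_image, Finset.mem_Ioc]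
      constructor
      · rintro ⟨⟨⟨i, hi, rfl⟩, h⟩, h'⟩
        have := hfv i
        exact ⟨⟨i, ⟨hi, by omega⟩, rfl⟩, h⟩
      · rintro ⟨⟨i, ⟨hi, hi'⟩, rfl⟩, h⟩
        have := hfv i
        exact ⟨⟨⟨i, hi, rfl⟩, h⟩, by omega⟩
    unfold gtPairs gtCount
    rw [this, Finset.card_product, Finset.card_image_of_injective _ hf.injective, Nat.card_Ioc]
    congr 1
    omega
  unfold Dfun
  rw [hbar, htil, gtPairs_union_aux _ _ _ hdisj, gtPairs_image_aux f hf, gtPairs_image_aux f hf,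
    hcnt, hgap]
  ring
end

section
/- Let 1 ≤ s < r and let I^M be a k-element subset of {1, …, 2s} with i + j ≠ 2s + 1 for all i, j ∈ I^M, and let I ⊆ {1, …, 2r} be the image of I^M under the map sending i to i if i ≤ s and to i + 2(r−s) if i > s. Then |I > Ĩ| − |I^M > Ĩ^M| = 2(r−s)·|I^M > s|, where |I^M > s| = #{i ∈ I^M : i > s}. (Moreover |I > Ī| = |I^M > Ī^M| and |I > r| = |I^M > s|.) -/
/--
Let `1 ≤ s < r` and let `I^M` be a `k`-element subset of `{1, …, 2s}` with
`i + j ≠ 2s + 1` for all `i, j ∈ I^M`; let `I ⊆ {1, …, 2r}` be the image of `I^M`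
under `i ↦ i` for `i ≤ s` and `i ↦ i + 2(r−s)` for `i > s`.  Then, with
`Ī = {2r+1−i : i ∈ I}`, `Ĩ = {1, …, 2r} \ (I ∪ Ī)` and similarly `Ī^M`, `Ĩ^M`:
`|I > Ĩ| − |I^M > Ĩ^M| = 2(r−s)·|I^M > s|`, `|I > Ī| = |I^M > Ī^M|`, and
`|I > r| = |I^M > s|`.
-/
theorem pair_count_jump_of_schubert_cells
    (r s k : ℕ) (hs : 1 ≤ s) (hsr : s < r)
    (IM : Finset ℕ) (hsub : IM ⊆ Finset.Icc 1 (2 * s)) (hcard : IM.card = k)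
    (hiso : ∀ i ∈ IM, ∀ j ∈ IM, i + j ≠ 2 * s + 1) :
    let I : Finset ℕ := IM.image fun i => if i ≤ s then i else i + 2 * (r - s)
    let Ibar : Finset ℕ := I.image fun i => 2 * r + 1 - i
    let Itil : Finset ℕ := Finset.Icc 1 (2 * r) \ (I ∪ Ibar)
    let IbarM : Finset ℕ := IM.image fun i => 2 * s + 1 - i
    let ItilM : Finset ℕ := Finset.Icc 1 (2 * s) \ (IM ∪ IbarM)
    gtPairs I Itil = gtPairs IM ItilM + 2 * (r - s) * gtCount IM s ∧
    gtPairs I Ibar = gtPairs IM IbarM ∧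
    gtCount I r = gtCount IM s := by
  intro I Ibar Itil IbarM ItilM
  set f : ℕ → ℕ := fun i => if i ≤ s then i else i + 2 * (r - s) with hfdef
  have hf : StrictMono f := by
    intro a b hab
    simp only [hfdef]
    split_ifs <;> omega
  have hI : I = IM.image f := rfl
  have hb : ∀ i ∈ IM, 1 ≤ i ∧ i ≤ 2 * s := fun i hi => Finset.mem_Icc.1 (hsub hi)
  have hbar : Ibar = IbarM.image f := by
    simp only [Ibar, IbarM, hI, Finset.image_image]
    apply Finset.image_congr
    intro i hi
    have := hb i hi
    simp only [hfdef, Function.comp]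
    split_ifs <;> omega
  have htil : Itil = ItilM.image f ∪ Finset.Icc (s + 1) (2 * r - s) := by
    have hu : I ∪ Ibar = (IM ∪ IbarM).image f := by rw [hI, hbar, Finset.image_union]
    have hIcc : Finset.Icc 1 (2 * r)
        = (Finset.Icc 1 (2 * s)).image f ∪ Finset.Icc (s + 1) (2 * r - s) := by
      ext x
      simp only [Finset.mem_union, Finset.mem_image, Finset.mem_Icc]
      constructor
      · intro hx
        by_cases h1 : x ≤ s
        · exact Or.inl ⟨x, by omega, by simp [hfdef, h1]⟩
        · by_cases h2 : x ≤ 2 * r - s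
          · right; omega
          · refine Or.inl ⟨x - 2 * (r - s), by omega, ?_⟩
            simp only [hfdef]
            split_ifs <;> omega
      · rintro (⟨y, hy, rfl⟩ | hx)
        · simp only [hfdef]
          split_ifs <;> omega
        · omega
    have hmid : Disjoint (Finset.Icc (s + 1) (2 * r - s)) ((IM ∪ IbarM).image f) := by
      rw [Finset.disjoint_right]
      intro x hx
      obtain ⟨y, -, rfl⟩ := Finset.mem_image.1 hx
      simp only [hfdef, Finset.mem_Icc]
      split_ifs <;> omega
    simp only [Itil, ItilM]
    rw [hu, hIcc, Finset.union_sdiff_distrib, Finset.sdiff_eq_self_of_disjoint hmid,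
      Finset.image_sdiff _ _ hf.injective]
  have hdisj : Disjoint (ItilM.image f) (Finset.Icc (s + 1) (2 * r - s)) := by
    rw [Finset.disjoint_left]
    intro x hx
    obtain ⟨y, -, rfl⟩ := Finset.mem_image.1 hx
    simp only [hfdef, Finset.mem_Icc]
    split_ifs <;> omega
  have hcnt : ∀ m, s ≤ m → m ≤ 2 * r - s →
      I.filter (fun i => m < i) = (IM.filter fun i => s < i).image f := by
    intro m h1 h2
    rw [hI, Finset.filter_image]
    congr 1
    apply Finset.filter_congr
    intro i hi
    simp only [hfdef]
    split_ifs <;> omega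
  refine ⟨?_, ?_, ?_⟩
  · rw [htil, gtPairs_union_aux _ _ _ hdisj, hI, gtPairs_image_aux f hf, ← hI]
    congr 1
    unfold gtPairs gtCount
    have : ((I ×ˢ Finset.Icc (s + 1) (2 * r - s)).filter fun p => p.2 < p.1)
        = (I.filter fun i => 2 * r - s < i) ×ˢ Finset.Icc (s + 1) (2 * r - s) := by
      ext ⟨x, y⟩
      simp only [Finset.mem_filter, Finset.mem_product, Finset.mem_Icc]
      constructor
      · rintro ⟨⟨hx, hy⟩, h⟩
        refine ⟨⟨hx, ?_⟩, hy⟩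
        rw [hI] at hx
        obtain ⟨z, -, rfl⟩ := Finset.mem_image.1 hx
        simp only [hfdef] at h ⊢
        split_ifs at h ⊢ <;> omega
      · rintro ⟨⟨hx, h⟩, hy⟩
        exact ⟨⟨hx, hy⟩, by omega⟩
    rw [this, Finset.card_product, hcnt _ (by omega) le_rfl,
      Finset.card_image_of_injective _ hf.injective, Nat.card_Icc, mul_comm]
    congr 1
    omega
  · rw [hbar, hI, gtPairs_image_aux f hf]
  · unfold gtCount
    rw [hcnt r (by omega) (by omega), Finset.card_image_of_injective _ hf.injective]
end
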